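/- Fix a positive integer p and a real number t ∈ (0,∞). Then lim_{n→∞} P{ (R_{n,p}+1)/√n ≤ t } = (2^{−C(p,2)} / Π_{i=0}^{p−1} i!) ∫_0^t (∂/∂z T_p(z,w))|_{z=t} dw, where T_p(z,w) = det_{0≤i,j<p}( (−1)^i Σ_{ℓ∈ℤ} H_{i+j}(ℓz) e^{−(ℓz)²} − Σ_{ℓ∈ℤ} H_{i+j}(ℓz+w) e^{−(ℓz+w)²} ) and C(p,2) = p(p−1)/2. -/

import Mathlib

open scoped BigOperators
open Filter MeasureTheory

/-- Binomial coefficient with integer lower argument, `0` outside range. -/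
def ichoose (a : ℕ) (b : ℤ) : ℕ := if 0 ≤ b then a.choose b.toNat else 0

/-- A `p`-watermelon of length `2n` (no wall): the `i`-th branch starts at `(0,2i)`,
ends at `(2n,2i)`, takes steps `(1,1)` or `(1,-1)`, and no two branches share a point.
`y i t` is the ordinate of the `i`-th branch at abscissa `t`. -/
def IsMelon (p n : ℕ) (y : Fin p → Fin (2*n+1) → ℤ) : Prop :=
  (∀ i, y i 0 = 2 * (i : ℤ)) ∧
  (∀ i, y i (Fin.last (2*n)) = 2 * (i : ℤ)) ∧
  (∀ i (t : Fin (2*n)), y i t.succ - y i t.castSucc = 1 ∨ y i t.succ - y i t.castSucc = -1) ∧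
  (∀ i j, i ≠ j → ∀ t, y i t ≠ y j t)

/-- The height of a watermelon: the maximal ordinate reached (by its top-most branch). -/
noncomputable def melonHeight {p n : ℕ} (y : Fin p → Fin (2*n+1) → ℤ) : ℤ :=
  sSup {v | ∃ i t, y i t = v}

/-- The depth of a watermelon: the minimal ordinate reached (by its bottom-most branch). -/
noncomputable def melonDepth {p n : ℕ} (y : Fin p → Fin (2*n+1) → ℤ) : ℤ :=
  sInf {v | ∃ i t, y i t = v}

/-- The range of a watermelon: height minus depth. -/
noncomputable def melonRange {p n : ℕ} (y : Fin p → Fin (2*n+1) → ℤ) : ℤ :=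
  melonHeight y - melonDepth y

/-- The `k`-th physicists' Hermite polynomial, via
`H_k(z)/k! = Σ_m ((-1)^(k-m)/(k-m)!) (2z)^(2m-k)/(2m-k)!` (terms with negative
factorial arguments being zero). -/
noncomputable def hermiteH (k : ℕ) (z : ℝ) : ℝ :=
  (k.factorial : ℝ) * ∑ m ∈ Finset.range (k+1),
    if k ≤ 2*m then ((-1:ℝ)^(k-m) / (k-m).factorial) * ((2*z)^(2*m-k) / (2*m-k).factorial)
    else 0

/-- The function `T_p(z,w)` from the range theorem. -/
noncomputable def Tfun (p : ℕ) (z w : ℝ) : ℝ :=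
  Matrix.det (Matrix.of fun i j : Fin p =>
    (-1:ℝ)^(i : ℕ) *
        (∑' ℓ : ℤ, hermiteH ((i : ℕ)+(j : ℕ)) ((ℓ : ℝ)*z) * Real.exp (-((ℓ : ℝ)*z)^2))
      - ∑' ℓ : ℤ, hermiteH ((i : ℕ)+(j : ℕ)) ((ℓ : ℝ)*z+w) * Real.exp (-((ℓ : ℝ)*z+w)^2))

open Topology

/-- Tuples of non-intersecting paths staying in `A`. -/
def PathSet (p T : ℕ) (A : Set ℤ) (x e : Fin p → ℤ) : Set (Fin (T+1) → Fin p → ℤ) :=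
  {y | y 0 = x ∧ y (Fin.last T) = e ∧
    (∀ (t : Fin T) i, y t.succ i - y t.castSucc i = 1 ∨ y t.succ i - y t.castSucc i = -1) ∧
    ∀ t, Function.Injective (y t) ∧ ∀ i, y t i ∈ A}

def stepv {p : ℕ} (s : Finset (Fin p)) (x : Fin p → ℤ) : Fin p → ℤ :=
  fun i => if i ∈ s then x i + 1 else x i - 1

lemma stepv_inj {p : ℕ} {s s' : Finset (Fin p)} {x : Fin p → ℤ} (h : stepv s x = stepv s' x) :
    s = s' := by
  ext i
  have := congrFun h i
  unfold stepv at this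
  by_cases h1 : i ∈ s <;> by_cases h2 : i ∈ s' <;> simp [h1, h2] at this ⊢ <;> omega

lemma cons_mem {p T : ℕ} {A : Set ℤ} {x e : Fin p → ℤ} (hx : Function.Injective x)
    (hA : ∀ i, x i ∈ A) (s : Finset (Fin p)) {y : Fin (T+1) → Fin p → ℤ}
    (hy : y ∈ PathSet p T A (stepv s x) e) :
    (Fin.cons x y : Fin (T+1+1) → Fin p → ℤ) ∈ PathSet p (T+1) A x e := by
  obtain ⟨h0, h1, h2, h3⟩ := hy
  refine ⟨by simp, ?_, ?_, ?_⟩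
  · rw [← Fin.succ_last, Fin.cons_succ, h1]
  · intro t i
    refine Fin.cases ?_ (fun t => ?_) t
    · simp only [Fin.cons_succ, Fin.castSucc_zero, Fin.cons_zero, h0, stepv]
      split_ifs
      · left; ring
      · right; ring
    · rw [← Fin.succ_castSucc]
      simp only [Fin.cons_succ]
      exact h2 t i
  · intro t
    refine Fin.cases ?_ (fun t => ?_) t
    · simpa using ⟨hx, hA⟩
    · simpa using h3 t

lemma tail_mem {p T : ℕ} {A : Set ℤ} {x e : Fin p → ℤ} {y : Fin (T+1+1) → Fin p → ℤ}
    (hy : y ∈ PathSet p (T+1) A x e) :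
    ∃ s : Finset (Fin p), Fin.tail y ∈ PathSet p T A (stepv s x) e := by
  obtain ⟨h0, h1, h2, h3⟩ := hy
  refine ⟨Finset.univ.filter (fun i => y 1 i = x i + 1), ?_, ?_, ?_, ?_⟩
  · funext i
    have := h2 0 i
    simp only [Fin.castSucc_zero, h0, Fin.succ_zero_eq_one] at this
    simp only [Fin.tail, stepv, Finset.mem_filter, Finset.mem_univ, true_and, Fin.succ_zero_eq_one]
    split_ifs with h
    · exact h
    · omega
  · simp only [Fin.tail, Fin.succ_last, h1]
  · intro t i
    simp only [Fin.tail]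
    have := h2 t.succ i
    rwa [← Fin.succ_castSucc] at this
  · intro t
    exact h3 t.succ

lemma pathSet_finite (p T : ℕ) (A : Set ℤ) (e : Fin p → ℤ) :
    ∀ x, (PathSet p T A x e).Finite := by
  induction T with
  | zero =>
    intro x
    refine Set.Finite.subset (Set.finite_singleton (fun _ => x)) ?_
    rintro y ⟨h0, -⟩
    simp only [Set.mem_singleton_iff]
    funext t
    have : t = 0 := Fin.ext (by simp)
    rw [this, h0]
  | succ T ih =>
    intro x
    refine Set.Finite.subset (Set.finite_iUnion (fun s : Finset (Fin p) =>
      (ih (stepv s x)).image (fun y => (Fin.cons x y : Fin (T+1+1) → Fin p → ℤ)))) ?_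
    intro y hy
    obtain ⟨s, hs⟩ := tail_mem hy
    simp only [Set.mem_iUnion]
    refine ⟨s, Fin.tail y, hs, ?_⟩
    have : x = y 0 := hy.1.symm
    simp only [this]
    exact Fin.cons_self_tail y

lemma card_succ {p T : ℕ} {A : Set ℤ} {x e : Fin p → ℤ} (hx : Function.Injective x)
    (hA : ∀ i, x i ∈ A) :
    Nat.card (PathSet p (T+1) A x e) =
      ∑ s : Finset (Fin p), Nat.card (PathSet p T A (stepv s x) e) := by
  have hfin : ∀ s : Finset (Fin p), Finite (PathSet p T A (stepv s x) e) :=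
    fun s => (pathSet_finite p T A e _).to_subtype
  rw [← Nat.card_sigma]
  symm
  refine Nat.card_eq_of_bijective (fun q : (Σ s : Finset (Fin p), PathSet p T A (stepv s x) e) =>
    (⟨Fin.cons x q.2.1, cons_mem hx hA q.1 q.2.2⟩ : PathSet p (T+1) A x e)) ⟨?_, ?_⟩
  · rintro ⟨s, y, hy⟩ ⟨s', y', hy'⟩ h
    simp only [Subtype.mk.injEq] at h
    have h' := Fin.cons_right_injective _ h
    have : s = s' := by
      apply stepv_inj (x := x)
      rw [← hy.1, ← hy'.1, h']
    subst this
    subst h'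
    rfl
  · rintro ⟨y, hy⟩
    obtain ⟨s, hs⟩ := tail_mem hy
    refine ⟨⟨s, Fin.tail y, hs⟩, ?_⟩
    simp only [Subtype.mk.injEq]
    have : x = y 0 := hy.1.symm
    simp only [this]
    exact Fin.cons_self_tail y

lemma card_emp {α : Type*} : ((Nat.card (∅ : Set α) : ℕ) : ℝ) = 0 := by simp

/-- Karlin-McGregor. -/
theorem km {p : ℕ} (A Z : Set ℤ) (e : Fin p → ℤ) (he : StrictMono e) (heA : ∀ i, e i ∈ A)
    (h : ℕ → Fin p → ℤ → ℝ)
    (h0 : ∀ j, ∀ x ∈ A, h 0 j x = if x = e j then 1 else 0)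
    (hs : ∀ T j x, h (T+1) j x = h T j (x+1) + h T j (x-1))
    (hZ : ∀ T j, ∀ x ∈ Z, h T j x = 0)
    (hZA : ∀ x ∈ Z, x ∉ A)
    (hA : ∀ x ∈ A, (x+1 ∈ A ∨ x+1 ∈ Z) ∧ (x-1 ∈ A ∨ x-1 ∈ Z)) :
    ∀ (T : ℕ) (x : Fin p → ℤ), Monotone x → (∀ i j, (2:ℤ) ∣ x i - x j) →
      (∀ i, x i ∈ A ∨ x i ∈ Z) →
      (Nat.card (PathSet p T A x e) : ℝ) = Matrix.det (Matrix.of fun i j => h T j (x i)) := by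
  intro T
  induction T with
  | zero =>
    intro x hm hpar hx
    by_cases hbad : ∃ i, x i ∈ Z
    · obtain ⟨i, hi⟩ := hbad
      rw [Matrix.det_eq_zero_of_row_eq_zero i (fun j => by simpa using hZ 0 j _ hi)]
      have : PathSet p 0 A x e = ∅ := by
        ext y
        simp only [Set.mem_empty_iff_false, iff_false]
        rintro ⟨h0, -, -, h3⟩
        have := (h3 0).2 i
        rw [h0] at this
        exact hZA _ hi this
      simp [this]
    push Not at hbad
    have hxA : ∀ i, x i ∈ A := fun i => (hx i).resolve_right (hbad i)
    by_cases hxe : x = e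
    · subst hxe
      have : (Matrix.of fun i j => h 0 j (x i)) = (1 : Matrix (Fin p) (Fin p) ℝ) := by
        ext i j
        simp only [Matrix.of_apply, h0 j _ (hxA i), Matrix.one_apply]
        simp [he.injective.eq_iff]
      rw [this, Matrix.det_one]
      have : PathSet p 0 A x x = {fun _ => x} := by
        ext y
        simp only [Set.mem_singleton_iff]
        constructor
        · rintro ⟨h0, -⟩
          funext t
          have : t = 0 := Fin.ext (by simp)
          rw [this, h0]
        · rintro rfl
          exact ⟨rfl, rfl, fun t => t.elim0, fun t => ⟨he.injective, hxA⟩⟩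
      simp [this]
    · have hemp : PathSet p 0 A x e = ∅ := by
        ext y
        simp only [Set.mem_empty_iff_false, iff_false]
        rintro ⟨h0, h1, -⟩
        apply hxe
        rw [← h0, ← h1]
        rfl
      rw [hemp, card_emp]
      symm
      by_cases hinj : Function.Injective x
      · have hsm : StrictMono x := hm.strictMono_of_injective hinj
        have : ∃ i, ∀ j, x i ≠ e j := by
          by_contra hcon
          push Not at hcon
          apply hxe
          have hsub : Finset.univ.image x ⊆ Finset.univ.image e := by
            intro a ha
            simp only [Finset.mem_image, Finset.mem_univ, true_and] at ha ⊢
            obtain ⟨i, rfl⟩ := ha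
            obtain ⟨j, hj⟩ := hcon i
            exact ⟨j, hj.symm⟩
          have heq := Finset.eq_of_subset_of_card_le hsub (by
            rw [Finset.card_image_of_injective _ hinj,
              Finset.card_image_of_injective _ he.injective])
          apply (StrictMono.range_inj hsm he).1
          have := congrArg (fun s : Finset ℤ => (s : Set ℤ)) heq
          simpa using this
        obtain ⟨i, hi⟩ := this
        exact Matrix.det_eq_zero_of_row_eq_zero i (fun j => by simp [h0 j _ (hxA i), hi j])
      · simp only [Function.Injective] at hinj
        push Not at hinj
        obtain ⟨i, j, hij, hne⟩ := hinj
        exact Matrix.det_zero_of_row_eq hne (by funext k; simp [hij])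
  | succ T ih =>
    intro x hm hpar hx
    by_cases hbad : ∃ i, x i ∈ Z
    · obtain ⟨i, hi⟩ := hbad
      rw [Matrix.det_eq_zero_of_row_eq_zero i (fun j => by simpa using hZ (T+1) j _ hi)]
      have : PathSet p (T+1) A x e = ∅ := by
        ext y
        simp only [Set.mem_empty_iff_false, iff_false]
        rintro ⟨h0, -, -, h3⟩
        have := (h3 0).2 i
        rw [h0] at this
        exact hZA _ hi this
      simp [this]
    push Not at hbad
    have hxA : ∀ i, x i ∈ A := fun i => (hx i).resolve_right (hbad i)
    by_cases hinj : Function.Injective x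
    · rw [card_succ hinj hxA]
      have hsm : StrictMono x := hm.strictMono_of_injective hinj
      push_cast
      have hdet : Matrix.det (Matrix.of fun i j => h (T+1) j (x i)) =
          ∑ s : Finset (Fin p), Matrix.det (Matrix.of fun i j => h T j (stepv s x i)) := by
        have := (Matrix.detRowAlternating (R := ℝ) (n := Fin p)).toMultilinearMap.map_add_univ
          (fun i j => h T j (x i + 1)) (fun i j => h T j (x i - 1))
        have e1 : (Matrix.of fun i j => h (T+1) j (x i)) =
          ((fun i j => h T j (x i + 1)) + (fun i j => h T j (x i - 1)) : Fin p → Fin p → ℝ) := by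
          funext i j
          simp [hs]
        rw [e1]
        refine this.trans ?_
        refine Finset.sum_congr rfl fun s _ => ?_
        change Matrix.det _ = _
        congr 1
        funext i j
        by_cases hi : i ∈ s <;> simp [stepv, Finset.piecewise, hi]
      rw [hdet]
      refine Finset.sum_congr rfl fun s _ => ?_
      apply ih
      · intro i j hij
        rcases hij.eq_or_lt with rfl | hlt
        · exact le_rfl
        · have h1 := hsm hlt
          have h2 := hpar j i
          simp only [stepv]
          split_ifs <;> omega
      · intro i j
        have h2 := hpar i j
        simp only [stepv]
        split_ifs <;> omega
      · intro i
        simp only [stepv]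
        split_ifs
        · exact (hA _ (hxA i)).1
        · exact (hA _ (hxA i)).2
    · have hemp : PathSet p (T+1) A x e = ∅ := by
        ext y
        simp only [Set.mem_empty_iff_false, iff_false]
        rintro ⟨h0, -, -, h3⟩
        apply hinj
        rw [← h0]
        exact (h3 0).1
      rw [hemp, card_emp]
      symm
      simp only [Function.Injective] at hinj
      push Not at hinj
      obtain ⟨i, j, hij, hne⟩ := hinj
      exact Matrix.det_zero_of_row_eq hne (by funext k; simp [hij])

/-- number of walks -/
noncomputable def Bw : ℕ → ℤ → ℝ
  | 0, d => if d = 0 then 1 else 0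
  | T+1, d => Bw T (d-1) + Bw T (d+1)

lemma Bw_support (T : ℕ) : ∀ d : ℤ, (T : ℤ) < |d| → Bw T d = 0 := by
  induction T with
  | zero => intro d hd; simp at hd; simp [Bw, hd]
  | succ T ih =>
    intro d hd
    push_cast at hd
    simp only [Bw]
    rw [ih (d-1) (by rcases abs_cases d with h | h <;> rcases abs_cases (d-1) with h' | h' <;> omega),
      ih (d+1) (by rcases abs_cases d with h | h <;> rcases abs_cases (d+1) with h' | h' <;> omega),
      add_zero]

lemma Bw_even (T : ℕ) : ∀ d : ℤ, Bw T (-d) = Bw T d := by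
  induction T with
  | zero => intro d; simp [Bw]
  | succ T ih =>
    intro d
    simp only [Bw]
    rw [← ih (d-1), ← ih (d+1), add_comm]
    congr 2 <;> ring

lemma Bw_nonneg (T : ℕ) : ∀ d : ℤ, 0 ≤ Bw T d := by
  induction T with
  | zero => intro d; simp only [Bw]; split_ifs <;> norm_num
  | succ T ih => intro d; exact add_nonneg (ih _) (ih _)

lemma Bw_pos (n : ℕ) : 0 < Bw (2*n) 0 := by
  induction n with
  | zero => simp [Bw]
  | succ n ih =>
    rw [show 2*(n+1) = 2*n+1+1 by ring]
    simp only [Bw]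
    have := Bw_nonneg (2*n) (0-1-1)
    have := Bw_nonneg (2*n) (0+1+1)
    norm_num at *
    linarith

lemma Bw_rec (T : ℕ) : ∀ d : ℤ, ((T:ℝ)+d+2) * Bw T (d+2) = ((T:ℝ)-d) * Bw T d := by
  induction T with
  | zero =>
    intro d
    simp only [Bw]
    by_cases h1 : d + 2 = 0
    · have : (d:ℝ) = -2 := by exact_mod_cast (by omega : d = -2)
      have h2 : d ≠ 0 := by omega
      simp [h2, this]
    · by_cases h2 : d = 0
      · simp [h2]
      · simp [h1, h2]
  | succ T ih =>
    intro d
    have a := ih (d-1)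
    have b := ih (d+1)
    simp only [Bw]
    rw [show d - 1 + 2 = d + 1 by ring] at a
    rw [show d + 1 + 2 = d + 2 + 1 by ring] at b
    rw [show d + 2 - 1 = d + 1 by ring]
    push_cast at *
    linarith

noncomputable def PB (T : ℕ) (W d : ℤ) : ℝ := ∑' ℓ : ℤ, Bw T (d + 2*ℓ*W)

lemma PB_finite (T : ℕ) (W d : ℤ) (hW : 1 ≤ W) :
    (Function.support (fun ℓ : ℤ => Bw T (d + 2*ℓ*W))).Finite := by
  refine (Set.finite_Icc (-(T + |d|)) (T+|d|)).subset ?_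
  intro ℓ hℓ
  have : |d + 2*ℓ*W| ≤ T := by
    by_contra hc
    exact hℓ (Bw_support T _ (by omega))
  rw [Set.mem_Icc, ← abs_le]
  have h1 : |2*ℓ*W| ≤ T + |d| := by
    have := abs_sub (d + 2*ℓ*W) d
    rw [add_sub_cancel_left] at this
    linarith
  rw [abs_mul, abs_mul, abs_of_pos (by omega : 0 < W)] at h1
  have h2 : 0 ≤ |ℓ| := abs_nonneg _
  norm_num at h1
  nlinarith

lemma PB_summable (T : ℕ) (W d : ℤ) (hW : 1 ≤ W) :
    Summable (fun ℓ : ℤ => Bw T (d + 2*ℓ*W)) :=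
  summable_of_hasFiniteSupport (PB_finite T W d hW)

lemma PB_succ (T : ℕ) (W d : ℤ) (hW : 1 ≤ W) : PB (T+1) W d = PB T W (d-1) + PB T W (d+1) := by
  unfold PB
  rw [← (PB_summable T W _ hW).tsum_add (PB_summable T W _ hW)]
  refine tsum_congr fun ℓ => ?_
  simp only [Bw]
  congr 2 <;> ring

lemma PB_period (T : ℕ) (W d : ℤ) : PB T W (d + 2*W) = PB T W d := by
  unfold PB
  rw [← (Equiv.addRight (1:ℤ)).tsum_eq (fun ℓ : ℤ => Bw T (d + 2*ℓ*W))]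
  refine tsum_congr fun ℓ => ?_
  simp only [Equiv.coe_addRight]
  congr 1; ring

lemma PB_zero_ne (W d : ℤ) (h : ∀ ℓ : ℤ, d + 2*ℓ*W ≠ 0) : PB 0 W d = 0 := by
  unfold PB
  simp [Bw, h]

lemma PB_zero_zero (W : ℤ) (hW : 1 ≤ W) : PB 0 W 0 = 1 := by
  unfold PB
  rw [tsum_eq_single 0]
  · simp [Bw]
  · intro ℓ hℓ
    have : W ≠ 0 := by omega
    simp [Bw, hℓ, this]

def melonIn (p n : ℕ) (A : Set ℤ) : Set (Fin p → Fin (2*n+1) → ℤ) :=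
  {y | IsMelon p n y ∧ ∀ i t, y i t ∈ A}

def ev (p : ℕ) : Fin p → ℤ := fun i => 2 * (i:ℤ)

lemma ev_mono (p : ℕ) : StrictMono (ev p) := by
  intro i j h
  have : (i:ℕ) < j := h
  simp only [ev]; omega

lemma mem_swap {p n : ℕ} {A : Set ℤ} (y : Fin p → Fin (2*n+1) → ℤ) :
    y ∈ melonIn p n A ↔ (fun t i => y i t) ∈ PathSet p (2*n) A (ev p) (ev p) := by
  constructor
  · rintro ⟨⟨h0, h1, h2, h3⟩, h4⟩
    refine ⟨funext h0, funext h1, fun t i => h2 i t, fun t => ⟨fun i j hij => ?_, fun i => h4 i t⟩⟩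
    by_contra hne
    exact h3 i j hne t hij
  · rintro ⟨h0, h1, h2, h3⟩
    refine ⟨⟨fun i => congrFun h0 i, fun i => congrFun h1 i, fun i t => h2 t i, ?_⟩,
      fun i t => (h3 t).2 i⟩
    intro i j hne t hij
    exact hne ((h3 t).1 hij)

lemma card_melonIn (p n : ℕ) (A : Set ℤ) :
    Nat.card (melonIn p n A) = Nat.card (PathSet p (2*n) A (ev p) (ev p)) := by
  refine Nat.card_congr ⟨fun y => ⟨fun t i => y.1 i t, (mem_swap y.1).1 y.2⟩,
    fun y => ⟨fun i t => y.1 t i, (mem_swap _).2 y.2⟩, fun y => rfl, fun y => rfl⟩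

lemma melonIn_finite (p n : ℕ) (A : Set ℤ) : (melonIn p n A).Finite := by
  have h := pathSet_finite p (2*n) A (ev p) (ev p)
  refine Set.Finite.of_finite_image (f := fun y t i => y i t) (h.subset ?_) ?_
  · rintro _ ⟨y, hy, rfl⟩
    exact (mem_swap y).1 hy
  · intro y _ z _ h
    funext i t
    exact congrFun (congrFun h t) i

noncomputable def FF (p n : ℕ) (W s : ℤ) : ℝ :=
  Matrix.det (Matrix.of fun i j : Fin p =>
    PB (2*n) W (2*(j:ℤ) - 2*(i:ℤ)) - PB (2*n) W (2*(j:ℤ) + 2*(i:ℤ) + 2*s))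

theorem total_card (p n : ℕ) : (Nat.card (melonIn p n Set.univ) : ℝ) =
    Matrix.det (Matrix.of fun i j : Fin p => Bw (2*n) (2*(j:ℤ) - 2*(i:ℤ))) := by
  rw [card_melonIn]
  refine km Set.univ ∅ (ev p) (ev_mono p) (fun _ => trivial)
    (fun T j x => Bw T (2*(j:ℤ) - x)) ?_ ?_ ?_ ?_ ?_ (2*n) (ev p) (ev_mono p).monotone ?_ ?_
  · intro j x _
    simp only [Bw, ev]
    congr 1
    simp only [eq_iff_iff]; omega
  · intro T j x
    simp only [Bw]
    congr 2; ring
    ring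
  · intro T j x hx; exact hx.elim
  · intro x hx; exact hx.elim
  · intro x _; simp
  · intro i j; simp only [ev]; omega
  · intro i; left; trivial

lemma melonIn_empty {p n : ℕ} {A : Set ℤ} (i : Fin p) (h : 2*(i:ℤ) ∉ A) :
    melonIn p n A = ∅ := by
  ext y
  simp only [Set.mem_empty_iff_false, iff_false]
  rintro ⟨⟨h0, -⟩, h4⟩
  exact h (h0 i ▸ h4 i 0)

theorem strip_card (p n : ℕ) (hp : 0 < p) (W s : ℤ) (hW : 1 ≤ W) (hs0 : 0 ≤ s) (hsW : s ≤ W) :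
    (Nat.card (melonIn p n (Set.Icc (1-s) (W-s-1))) : ℝ) = FF p n W s := by
  by_cases hs : s = 0
  · subst hs
    rw [melonIn_empty ⟨0, hp⟩ (by simp), card_emp]
    symm
    unfold FF
    exact Matrix.det_eq_zero_of_row_eq_zero ⟨0, hp⟩ (fun j => by simp)
  by_cases hb : 2*((p:ℤ)-1) ≤ W - s - 1
  · rw [card_melonIn]
    unfold FF
    have hmem : ∀ i : Fin p, 1 - s ≤ 2*(i:ℤ) ∧ 2*(i:ℤ) ≤ W-s-1 := by
      intro i
      have := i.2
      omega
    refine (km (Set.Icc (1-s) (W-s-1)) {-s, W-s} (ev p) (ev_mono p) hmem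
      (fun T j x => PB T W (2*(j:ℤ) - x) - PB T W (2*(j:ℤ) + x + 2*s)) ?_ ?_ ?_ ?_ ?_ (2*n) (ev p)
      (ev_mono p).monotone ?_ ?_).trans ?_
    · intro j x hx
      have hj := hmem j
      simp only [Set.mem_Icc] at hx
      have e2 : PB 0 W (2*(j:ℤ) + x + 2*s) = 0 := by
        apply PB_zero_ne
        intro ℓ hℓ
        rcases le_or_gt 0 ℓ with h | h
        · have : 0 ≤ ℓ * W := by positivity
          nlinarith
        · have : ℓ * W ≤ (-1) * W := by apply mul_le_mul_of_nonneg_right <;> omega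
          nlinarith
      simp only [e2, sub_zero]
      by_cases h : x = ev p j
      · rw [if_pos h, h, ev, sub_self, PB_zero_zero W hW]
      · rw [if_neg h]
        unfold ev at h
        apply PB_zero_ne
        intro ℓ hℓ
        rcases lt_trichotomy ℓ 0 with h' | h' | h'
        · have : ℓ * W ≤ (-1) * W := by apply mul_le_mul_of_nonneg_right <;> omega
          nlinarith
        · subst h'; omega
        · have : 1 * W ≤ ℓ * W := by apply mul_le_mul_of_nonneg_right <;> omega
          nlinarith
    · intro T j x
      rw [PB_succ T W _ hW, PB_succ T W _ hW]
      rw [show 2*(j:ℤ) - (x+1) = 2*(j:ℤ) - x - 1 by ring,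
        show 2*(j:ℤ) - (x-1) = 2*(j:ℤ) - x + 1 by ring,
        show 2*(j:ℤ) + (x+1) + 2*s = 2*(j:ℤ) + x + 2*s + 1 by ring,
        show 2*(j:ℤ) + (x-1) + 2*s = 2*(j:ℤ) + x + 2*s - 1 by ring]
      ring
    · intro T j x hx
      rcases hx with rfl | hx
      · rw [sub_eq_zero]; congr 1; ring
      · rw [Set.mem_singleton_iff] at hx
        subst hx
        rw [sub_eq_zero, ← PB_period]; congr 1; ring
    · rintro x (rfl | hx)
      · simp
      · rw [Set.mem_singleton_iff] at hx
        subst hx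
        simp
    · intro x hx
      simp only [Set.mem_Icc, Set.mem_insert_iff, Set.mem_singleton_iff] at *
      omega
    · intro i j; simp only [ev]; omega
    · intro i; left; exact hmem i
    · rfl
  · have hp1 : p - 1 < p := by omega
    rw [melonIn_empty ⟨p-1, hp1⟩ (by simp only [Set.mem_Icc]; omega), card_emp]
    symm
    unfold FF
    rcases Int.even_or_odd' (W - s) with ⟨k, hk | hk⟩
    · refine Matrix.det_eq_zero_of_row_eq_zero ⟨k.toNat, by omega⟩ (fun j => ?_)
      have : ((k.toNat : ℕ) : ℤ) = k := by omega
      simp only [Matrix.of_apply, this]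
      rw [sub_eq_zero, ← PB_period]
      congr 1; omega
    · have hk0 : ((k.toNat : ℕ) : ℤ) = k := by omega
      set i1 : Fin p := ⟨k.toNat, by omega⟩
      set i2 : Fin p := ⟨k.toNat + 1, by omega⟩
      have hne : i1 ≠ i2 := by simp [i1, i2]
      have hi1 : ((i1 : ℕ) : ℤ) = k := hk0
      have hi2 : ((i2 : ℕ) : ℤ) = k + 1 := by simp [i2, hk0]
      rw [← Matrix.det_updateRow_add_self _ hne]
      refine Matrix.det_eq_zero_of_row_eq_zero i1 (fun j => ?_)
      simp only [Matrix.updateRow_self, Pi.add_apply, Matrix.of_apply, hi1, hi2]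
      have e1 : PB (2*n) W (2*(j:ℤ) + 2*(k+1) + 2*s) = PB (2*n) W (2*(j:ℤ) - 2*k) := by
        rw [← PB_period _ _ (2*(j:ℤ) - 2*k)]; congr 1; omega
      have e2 : PB (2*n) W (2*(j:ℤ) + 2*k + 2*s) = PB (2*n) W (2*(j:ℤ) - 2*(k+1)) := by
        rw [← PB_period _ _ (2*(j:ℤ) - 2*(k+1))]; congr 1; omega
      rw [e1, e2]; ring

lemma melon_facts {p n : ℕ} (hp : 0 < p) (y : Fin p → Fin (2*n+1) → ℤ) :
    (∃ i t, y i t = melonDepth y) ∧ (∃ i t, y i t = melonHeight y) ∧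
    ∀ i t, melonDepth y ≤ y i t ∧ y i t ≤ melonHeight y := by
  have hfin : {v | ∃ i t, y i t = v}.Finite := by
    refine (Set.finite_range (fun q : Fin p × Fin (2*n+1) => y q.1 q.2)).subset ?_
    rintro v ⟨i, t, rfl⟩
    exact ⟨(i, t), rfl⟩
  have hne : {v | ∃ i t, y i t = v}.Nonempty := ⟨_, ⟨0, hp⟩, 0, rfl⟩
  exact ⟨Int.csInf_mem hne hfin.bddBelow, Int.csSup_mem hne hfin.bddAbove,
    fun i t => ⟨csInf_le hfin.bddBelow ⟨i, t, rfl⟩, le_csSup hfin.bddAbove ⟨i, t, rfl⟩⟩⟩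

theorem count_sum (p n : ℕ) (hp : 0 < p) (r : ℕ) :
    (Nat.card {y : Fin p → Fin (2*n+1) → ℤ // IsMelon p n y ∧ melonRange y ≤ r} : ℝ) =
      ∑ s ∈ Finset.range (r+2), (FF p n ((r:ℤ)+2) s - FF p n ((r:ℤ)+1) s) := by
  classical
  set M : Set (Fin p → Fin (2*n+1) → ℤ) := {y | IsMelon p n y ∧ melonRange y ≤ r} with hM
  have hMf : M.Finite := (melonIn_finite p n Set.univ).subset (fun y hy => ⟨hy.1, fun _ _ => trivial⟩)
  have hcard : Nat.card {y : Fin p → Fin (2*n+1) → ℤ // IsMelon p n y ∧ melonRange y ≤ r}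
      = hMf.toFinset.card := by
    rw [← Set.ncard_eq_toFinset_card M hMf]; rfl
  have hdep : ∀ y ∈ M, melonDepth y ≤ 0 ∧ -(r:ℤ) ≤ melonDepth y := by
    intro y hy
    have h := (melon_facts hp y).2.2 ⟨0, hp⟩ 0
    have h0 := hy.1.1 ⟨0, hp⟩
    have hr := hy.2
    unfold melonRange at hr
    simp only [h0] at h
    simp at h
    constructor <;> omega
  rw [hcard, Finset.card_eq_sum_card_fiberwise (f := fun y => (-melonDepth y).toNat)
    (t := Finset.range (r+1))]
  · push_cast
    have key : ∀ u ∈ Finset.range (r+1),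
        (((hMf.toFinset.filter (fun y => (-melonDepth y).toNat = u)).card : ℕ) : ℝ) =
        FF p n ((r:ℤ)+2) ((u+1 : ℕ):ℤ) - FF p n ((r:ℤ)+1) u := by
      intro u hu
      have hu' := Finset.mem_range.1 hu
      rw [← strip_card p n hp _ _ (by omega) (by omega) (by omega),
        ← strip_card p n hp _ _ (by omega) (by omega) (by omega)]
      rw [show (1 - ((u+1:ℕ):ℤ)) = -(u:ℤ) by push_cast; ring,
        show (r:ℤ) + 2 - ((u+1:ℕ):ℤ) - 1 = r - u by push_cast; ring,
        show (r:ℤ) + 1 - (u:ℤ) - 1 = r - u by ring]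
      set S1 := melonIn p n (Set.Icc (-(u:ℤ)) (r-u))
      set S2 := melonIn p n (Set.Icc (1-(u:ℤ)) (r-u))
      have hsub : S2 ⊆ S1 := by
        intro y hy
        refine ⟨hy.1, fun i t => ?_⟩
        have := hy.2 i t
        simp only [Set.mem_Icc] at this ⊢
        omega
      have hset : ((hMf.toFinset.filter (fun y => (-melonDepth y).toNat = u) :
          Finset (Fin p → Fin (2*n+1) → ℤ)) : Set _) = S1 \ S2 := by
        ext y
        simp only [Finset.coe_filter, Set.Finite.mem_toFinset, Set.mem_ofPred_eq, Set.mem_sdiff]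
        have hf := melon_facts hp y
        obtain ⟨⟨i1, t1, h1⟩, ⟨i2, t2, h2⟩, h3⟩ := hf
        constructor
        · rintro ⟨hy, hd⟩
          have hd' := hdep y hy
          have hr := hy.2
          unfold melonRange at hr
          refine ⟨⟨hy.1, fun i t => ?_⟩, fun hy2 => ?_⟩
          · have := h3 i t
            simp only [Set.mem_Icc]
            omega
          · have := hy2.2 i1 t1
            simp only [Set.mem_Icc] at this
            omega
        · rintro ⟨hy1, hy2⟩
          have a1 := hy1.2 i1 t1
          have a2 := hy1.2 i2 t2
          simp only [Set.mem_Icc] at a1 a2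
          have hdd : melonDepth y = -u := by
            by_contra hne
            apply hy2
            refine ⟨hy1.1, fun i t => ?_⟩
            have := h3 i t
            have b := hy1.2 i t
            simp only [Set.mem_Icc] at b ⊢
            omega
          refine ⟨⟨hy1.1, ?_⟩, ?_⟩
          · unfold melonRange; omega
          · omega
      have hS1 := melonIn_finite p n (Set.Icc (-(u:ℤ)) (r-u))
      have hS2 := melonIn_finite p n (Set.Icc (1-(u:ℤ)) (r-u))
      have e1 := Set.ncard_sdiff_add_ncard_of_subset hsub hS1
      rw [← Set.ncard_coe_finset, hset]
      change ((S1 \ S2).ncard : ℝ) = (S1.ncard : ℝ) - (S2.ncard : ℝ)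
      rw [← e1]; push_cast; ring
    rw [Finset.sum_congr rfl key, Finset.sum_sub_distrib, Finset.sum_sub_distrib]
    rw [Finset.sum_range_succ' (fun s : ℕ => FF p n ((r:ℤ)+2) s) (r+1)]
    rw [Finset.sum_range_succ (fun s : ℕ => FF p n ((r:ℤ)+1) s) (r+1)]
    have z1 : FF p n ((r:ℤ)+2) ((0:ℕ):ℤ) = 0 := by
      rw [← strip_card p n hp _ _ (by omega) (by omega) (by omega),
        melonIn_empty ⟨0, hp⟩ (by simp), card_emp]
    have z2 : FF p n ((r:ℤ)+1) ((r+1:ℕ):ℤ) = 0 := by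
      rw [← strip_card p n hp _ _ (by omega) (by omega) (by omega),
        melonIn_empty ⟨0, hp⟩ (by simp), card_emp]
    rw [z1, z2, add_zero, add_zero]
  · intro y hy
    have hy' := hdep y (hMf.mem_toFinset.1 hy)
    simp only [Finset.coe_range, Set.mem_Iio]
    omega

open Polynomial in
noncomputable def Hp : ℕ → Polynomial ℝ
  | 0 => 1
  | k+1 => C 2 * X * Hp k - derivative (Hp k)

open Polynomial in
lemma Hp_deriv (k : ℕ) : derivative (Hp (k+1)) = C (2*((k:ℝ)+1)) * Hp k := by
  induction k with
  | zero => simp [Hp]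
  | succ k ih =>
    have : Hp (k+1+1) = C 2 * X * Hp (k+1) - derivative (Hp (k+1)) := rfl
    rw [this, derivative_sub, derivative_mul, ih, derivative_mul, derivative_C_mul]
    have h2 : Hp (k+1) = C 2 * X * Hp k - derivative (Hp k) := rfl
    have h3 : derivative (Hp k) = C 2 * X * Hp k - Hp (k+1) := by rw [h2]; ring
    rw [h3]
    simp only [derivative_C, derivative_X, map_mul, map_add, Nat.cast_add, Nat.cast_one]
    simp only [map_one]
    ring

lemma Hp_rec (k : ℕ) (x : ℝ) : (Hp (k+1)).eval x =
    2*x*(Hp k).eval x - 2*(k:ℝ)*(Hp (k-1)).eval x := by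
  cases k with
  | zero => simp [Hp]
  | succ k =>
    have : Hp (k+1+1) = Polynomial.C 2 * Polynomial.X * Hp (k+1) - Polynomial.derivative (Hp (k+1)) := rfl
    rw [this, Hp_deriv]
    simp

lemma hermiteH_rec (k : ℕ) (z : ℝ) : hermiteH (k+2) z =
    2*z*hermiteH (k+1) z - 2*((k:ℝ)+1) * hermiteH k z := by
  unfold hermiteH
  rw [Finset.sum_range_succ' _ (k+2)]
  rw [Finset.sum_range_succ _ (k+1)]
  rw [Finset.sum_range_succ _ (k+1)]
  have key : ∀ m ∈ Finset.range (k+1),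
     ((k+2).factorial : ℝ) * (if k+2 ≤ 2*(m+1) then ((-1:ℝ)^(k+2-(m+1)) / (k+2-(m+1)).factorial) * ((2*z)^(2*(m+1)-(k+2)) / (2*(m+1)-(k+2)).factorial) else 0)
     = 2*z*((k+1).factorial * (if k+1 ≤ 2*m then ((-1:ℝ)^(k+1-m) / (k+1-m).factorial) * ((2*z)^(2*m-(k+1)) / (2*m-(k+1)).factorial) else 0))
      - 2*((k:ℝ)+1) * (k.factorial * (if k ≤ 2*m then ((-1:ℝ)^(k-m) / (k-m).factorial) * ((2*z)^(2*m-k) / (2*m-k).factorial) else 0)) := by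
    intro m hm
    have hm' := Finset.mem_range.1 hm
    rcases lt_trichotomy k (2*m) with h | h | h
    · obtain ⟨a, ha⟩ : ∃ a, k = m + a := ⟨k - m, by omega⟩
      obtain ⟨b, hb⟩ : ∃ b, m = a + b + 1 := ⟨m - a - 1, by omega⟩
      rw [if_pos (by omega), if_pos (by omega), if_pos (by omega)]
      rw [show k+2-(m+1) = a+1 by omega, show k+1-m = a+1 by omega, show k - m = a by omega,
        show 2*(m+1)-(k+2) = b+1 by omega, show 2*m-(k+1) = b by omega, show 2*m-k = b+1 by omega]
      have hk : (k:ℝ) = 2*a+b+1 := by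
        have : k = 2*a+b+1 := by omega
        rw [this]; push_cast; ring
      simp only [Nat.factorial_succ, pow_succ]
      push_cast
      rw [hk]
      have := Nat.factorial_ne_zero a
      have := Nat.factorial_ne_zero b
      field_simp
      ring
    · rw [if_pos (by omega), if_neg (by omega), if_pos (by omega)]
      rw [show k+2-(m+1) = m+1 by omega, show k - m = m by omega,
        show 2*(m+1)-(k+2) = 0 by omega, show 2*m-k = 0 by omega]
      have hk : (k:ℝ) = 2*m := by rw [h]; push_cast; ring
      simp only [Nat.factorial_succ, pow_succ]
      push_cast
      rw [hk]
      have := Nat.factorial_ne_zero m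
      field_simp
      ring
    · rw [if_neg (by omega), if_neg (by omega), if_neg (by omega)]
      ring
  have e1 := Finset.sum_congr rfl key
  rw [Finset.sum_sub_distrib] at e1
  simp only [← Finset.mul_sum] at e1
  have e2 : ((k+2).factorial : ℝ) * (if k+2 ≤ 2*(k+1+1) then ((-1:ℝ)^(k+2-(k+1+1)) / (k+2-(k+1+1)).factorial) * ((2*z)^(2*(k+1+1)-(k+2)) / (2*(k+1+1)-(k+2)).factorial) else 0)
     = 2*z*((k+1).factorial * (if k+1 ≤ 2*(k+1) then ((-1:ℝ)^(k+1-(k+1)) / (k+1-(k+1)).factorial) * ((2*z)^(2*(k+1)-(k+1)) / (2*(k+1)-(k+1)).factorial) else 0)) := by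
    rw [if_pos (by omega), if_pos (by omega)]
    rw [show k+2-(k+1+1) = 0 by omega, show k+1-(k+1) = 0 by omega,
      show 2*(k+1+1)-(k+2) = k+2 by omega, show 2*(k+1)-(k+1) = k+1 by omega]
    have := Nat.factorial_ne_zero (k+1)
    have := Nat.factorial_ne_zero (k+2)
    field_simp
    ring
  rw [if_neg (by omega : ¬ (k+2 ≤ 2*0))]
  rw [add_zero]
  linear_combination e1 + e2

lemma hermiteH_eq (k : ℕ) (z : ℝ) : hermiteH k z = (Hp k).eval z := by
  induction k using Nat.strong_induction_on with
  | _ k ih =>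
    match k with
    | 0 => simp [hermiteH, Hp]
    | 1 => simp [hermiteH, Hp, Finset.sum_range_succ]
    | k+2 =>
      rw [hermiteH_rec, ih (k+1) (by omega), ih k (by omega), Hp_rec (k+1)]
      simp

noncomputable def GG (m : ℕ) (x : ℝ) : ℝ := hermiteH m x * Real.exp (-x^2)

lemma GG_rec (m : ℕ) (x : ℝ) : GG (m+1) x = 2*x*GG m x - 2*(m:ℝ)*GG (m-1) x := by
  unfold GG
  rw [hermiteH_eq, hermiteH_eq, hermiteH_eq, Hp_rec]; ring

lemma GG_zero (x : ℝ) : GG 0 x = Real.exp (-x^2) := by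
  unfold GG
  rw [hermiteH_eq]; simp [Hp]

lemma GG_deriv (m : ℕ) (x : ℝ) : HasDerivAt (GG m) (-GG (m+1) x) x := by
  have h1 : HasDerivAt (fun x => (Hp m).eval x) ((Polynomial.derivative (Hp m)).eval x) x :=
    (Hp m).hasDerivAt x
  have h2 : HasDerivAt (fun x : ℝ => Real.exp (-x^2)) (Real.exp (-x^2) * (-(2*x))) x := by
    have := ((hasDerivAt_pow 2 x).neg).exp
    simpa using this
  have h3 := h1.mul h2
  have e : GG m = fun x => (Hp m).eval x * Real.exp (-x^2) := by
    funext x; unfold GG; rw [hermiteH_eq]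
  rw [e]
  refine h3.congr_deriv ?_
  unfold GG
  rw [hermiteH_eq]
  have : Hp (m+1) = Polynomial.C 2 * Polynomial.X * Hp m - Polynomial.derivative (Hp m) := rfl
  rw [this]
  simp
  ring

/-! determinant at zero -/
open Polynomial in
lemma Hp_decomp (i : ℕ) : ∃ c : ℕ → ℝ[X], c i = C ((-1)^i) ∧ (∀ k, i < k → c k = 0) ∧
    ∀ j, Hp (i+j) = ∑ k ∈ Finset.range (i+1), c k * derivative^[k] (Hp j) := by
  induction i with
  | zero =>
    refine ⟨fun k => if k = 0 then 1 else 0, by simp, ?_, ?_⟩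
    · intro k hk; simp; omega
    · intro j; simp
  | succ i ih =>
    obtain ⟨c, h1, h2, h3⟩ := ih
    refine ⟨fun k => C 2 * X * c k - derivative (c k) - (if k = 0 then 0 else c (k-1)), ?_, ?_, ?_⟩
    · simp [h1, h2 (i+1) (by omega), pow_succ]
    · intro k hk
      simp [h2 k (by omega), h2 (k-1) (by omega)]
    · intro j
      have : Hp (i+1+j) = C 2 * X * Hp (i+j) - derivative (Hp (i+j)) := by
        rw [show i+1+j = (i+j)+1 by ring]; rfl
      rw [this, h3 j, derivative_sum]
      simp only [derivative_mul, sub_mul]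
      rw [Finset.sum_sub_distrib, Finset.sum_sub_distrib, Finset.sum_add_distrib]
      rw [Finset.sum_range_succ (fun k => C 2 * X * c k * _) (i+1),
        Finset.sum_range_succ (fun k => derivative (c k) * _) (i+1),
        Finset.sum_range_succ' (fun k => (if k = 0 then 0 else c (k-1)) * _) (i+1)]
      simp only [h2 (i+1) (by omega), Function.iterate_succ_apply', Finset.mul_sum]
      simp [mul_assoc, sub_sub]

open Polynomial in
lemma Hp_iter_zero (j : ℕ) : ∀ k, j < k → derivative^[k] (Hp j) = 0 := by
  induction j with
  | zero =>
    intro k hk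
    obtain ⟨k, rfl⟩ : ∃ l, k = l+1 := ⟨k-1, by omega⟩
    simp [Hp, Function.iterate_succ_apply]
  | succ j ih =>
    intro k hk
    obtain ⟨k, rfl⟩ : ∃ l, k = l+1 := ⟨k-1, by omega⟩
    rw [Function.iterate_succ_apply, Hp_deriv, iterate_derivative_C_mul, ih k (by omega), mul_zero]

open Polynomial in
lemma Hp_iter_self (j : ℕ) : derivative^[j] (Hp j) = C (2^j * (j.factorial : ℝ)) := by
  induction j with
  | zero => simp [Hp]
  | succ j ih =>
    rw [Function.iterate_succ_apply, Hp_deriv, iterate_derivative_C_mul, ih, ← C_mul]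
    congr 1
    rw [Nat.factorial_succ]; push_cast; ring

lemma det_zero_eval (p : ℕ) :
    Matrix.det (Matrix.of fun i j : Fin p => (-1:ℝ)^(i:ℕ) * GG ((i:ℕ)+(j:ℕ)) 0) =
      2^(p.choose 2) * ∏ i ∈ Finset.range p, (i.factorial : ℝ) := by
  choose c h1 h2 h3 using Hp_decomp
  set Lm : Matrix (Fin p) (Fin p) ℝ := Matrix.of fun i k => (-1:ℝ)^(i:ℕ) * (c i k).eval 0
  set U : Matrix (Fin p) (Fin p) ℝ := Matrix.of fun k j => (Polynomial.derivative^[(k:ℕ)] (Hp j)).eval 0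
  have hM : (Matrix.of fun i j : Fin p => (-1:ℝ)^(i:ℕ) * GG ((i:ℕ)+(j:ℕ)) 0) = Lm * U := by
    ext i j
    simp only [Matrix.of_apply, Matrix.mul_apply, Lm, U]
    unfold GG
    rw [hermiteH_eq, h3, Polynomial.eval_finsetSum]
    simp only [Polynomial.eval_mul, mul_assoc]
    rw [← Finset.mul_sum]
    congr 1
    simp only [ne_eq, OfNat.ofNat_ne_zero, not_false_eq_true, zero_pow, neg_zero, Real.exp_zero, mul_one]
    rw [Fin.sum_univ_eq_sum_range (fun k => (c i k).eval 0 * (Polynomial.derivative^[k] (Hp j)).eval 0) p]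
    refine Finset.sum_subset ?_ ?_
    · intro k hk
      have := i.2
      simp only [Finset.mem_range] at hk ⊢
      omega
    · intro k _ hk
      simp only [Finset.mem_range] at hk
      rw [h2 i k (by omega)]; simp
  rw [hM, Matrix.det_mul]
  have hL : Lm.det = 1 := by
    rw [Matrix.det_of_isLowerTriangular]
    · apply Finset.prod_eq_one
      intro i _
      simp only [Lm, Matrix.of_apply, h1, Polynomial.eval_C]
      rw [← mul_pow]; simp
    · intro i k hik
      have hik' : i < k := hik
      simp only [Lm, Matrix.of_apply]
      rw [h2 i k hik']; simp
  have hU : U.det = ∏ i : Fin p, (2^(i:ℕ) * ((i:ℕ).factorial : ℝ)) := by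
    rw [Matrix.det_of_isUpperTriangular]
    · apply Finset.prod_congr rfl
      intro i _
      simp only [U, Matrix.of_apply, Hp_iter_self, Polynomial.eval_C]
    · intro k j hkj
      have hkj' : j < k := hkj
      simp only [U, Matrix.of_apply]
      rw [Hp_iter_zero j k hkj']; simp
  rw [hL, hU, one_mul, Fin.prod_univ_eq_prod_range (fun i => (2:ℝ)^i * (i.factorial:ℝ)) p,
    Finset.prod_mul_distrib, Finset.prod_pow_eq_pow_sum, Finset.sum_range_id, Nat.choose_two_right]

noncomputable def ph (n : ℕ) (k : ℤ) : ℝ := Bw (2*n) (2*k) / Bw (2*n) 0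

def Nb (f : ℤ → ℝ) : ℕ → ℤ → ℝ
  | 0, k => f k
  | m+1, k => Nb f m k - Nb f m (k+1)

noncomputable def DD (n m : ℕ) (k : ℤ) : ℝ := (Real.sqrt n)^m * Nb (ph n) m k

lemma ph_rec (n : ℕ) (k : ℤ) : ((n:ℝ)+k+1) * ph n (k+1) = ((n:ℝ)-k) * ph n k := by
  have h := Bw_rec (2*n) (2*k)
  have hp := (Bw_pos n).ne'
  unfold ph
  rw [show 2*(k+1) = 2*k+2 by ring]
  push_cast at h
  field_simp
  linarith

lemma ph_even (n : ℕ) (k : ℤ) : ph n (-k) = ph n k := by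
  unfold ph
  rw [show 2*(-k) = -(2*k) by ring, Bw_even]

lemma ph_zero (n : ℕ) : ph n 0 = 1 := by
  unfold ph
  simpa using div_self (Bw_pos n).ne'

lemma ph_nonneg (n : ℕ) (k : ℤ) : 0 ≤ ph n k := div_nonneg (Bw_nonneg _ _) (Bw_nonneg _ _)

lemma ph_support (n : ℕ) (k : ℤ) (h : (n:ℤ) < |k|) : ph n k = 0 := by
  unfold ph
  rw [Bw_support, zero_div]
  rw [abs_mul]; push_cast; norm_num; exact h

lemma ph_abs (n : ℕ) (k : ℤ) : ph n k = ph n (k.natAbs : ℤ) := by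
  rcases Int.natAbs_eq k with h | h
  · rw [← h]
  · rw [← ph_even, ← neg_eq_iff_eq_neg.2 h]

lemma ph_bounds (n K : ℕ) (hK : K ≤ n) : ∀ k : ℕ, k ≤ K →
    Real.exp (-(k:ℝ)^2/((n:ℝ)-K+1)) ≤ ph n k ∧ ph n k ≤ Real.exp (-(k:ℝ)^2/((n:ℝ)+K)) := by
  intro k
  have hKn : (K:ℝ) ≤ n := by exact_mod_cast hK
  induction k with
  | zero => intro _; simp [ph_zero]
  | succ k ih =>
    intro hk
    obtain ⟨h1, h2⟩ := ih (by omega)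
    have hkK : (k:ℝ) + 1 ≤ K := by exact_mod_cast hk
    have hk0 : (0:ℝ) ≤ k := Nat.cast_nonneg k
    have hr := ph_rec n k
    push_cast at hr ⊢
    have hA : (0:ℝ) < (n:ℝ)+k+1 := by positivity
    have hB : (0:ℝ) < (n:ℝ)-k := by linarith
    have hC : (0:ℝ) < (n:ℝ)-K+1 := by linarith
    have hD : (0:ℝ) < (n:ℝ)+K := by linarith
    have hval : ph n ((k:ℤ)+1) = (((n:ℝ)-k)/((n:ℝ)+k+1)) * ph n k := by
      field_simp; linarith
    rw [hval]
    constructor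
    · have e1 : Real.exp (-((k:ℝ)+1)^2/((n:ℝ)-K+1)) =
          Real.exp (-(2*(k:ℝ)+1)/((n:ℝ)-K+1)) * Real.exp (-(k:ℝ)^2/((n:ℝ)-K+1)) := by
        rw [← Real.exp_add]; congr 1; ring
      rw [e1]
      apply mul_le_mul _ h1 (Real.exp_nonneg _) (by positivity)
      have h3 : (2*(k:ℝ)+1)/((n:ℝ)-k) ≤ (2*(k:ℝ)+1)/((n:ℝ)-K+1) := by
        apply div_le_div_of_nonneg_left (by positivity) hC (by linarith)
      have h4 := Real.add_one_le_exp ((2*(k:ℝ)+1)/((n:ℝ)-k))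
      have h5 : ((n:ℝ)+k+1)/((n:ℝ)-k) = (2*(k:ℝ)+1)/((n:ℝ)-k) + 1 := by field_simp; ring
      have h6 : ((n:ℝ)+k+1)/((n:ℝ)-k) ≤ Real.exp ((2*(k:ℝ)+1)/((n:ℝ)-K+1)) := by
        rw [h5]; exact h4.trans (Real.exp_le_exp.2 h3)
      rw [neg_div, Real.exp_neg]
      rw [show ((n:ℝ)-k)/((n:ℝ)+k+1) = (((n:ℝ)+k+1)/((n:ℝ)-k))⁻¹ by rw [inv_div]]
      exact inv_anti₀ (by positivity) h6
    · have e1 : Real.exp (-((k:ℝ)+1)^2/((n:ℝ)+K)) =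
          Real.exp (-(2*(k:ℝ)+1)/((n:ℝ)+K)) * Real.exp (-(k:ℝ)^2/((n:ℝ)+K)) := by
        rw [← Real.exp_add]; congr 1; ring
      rw [e1]
      apply mul_le_mul _ h2 (ph_nonneg _ _) (Real.exp_nonneg _)
      have h3 : (2*(k:ℝ)+1)/((n:ℝ)+K) ≤ (2*(k:ℝ)+1)/((n:ℝ)+k+1) := by
        apply div_le_div_of_nonneg_left (by positivity) hA (by linarith)
      have h4 := Real.add_one_le_exp (-(2*(k:ℝ)+1)/((n:ℝ)+k+1))
      have h5 : ((n:ℝ)-k)/((n:ℝ)+k+1) = -(2*(k:ℝ)+1)/((n:ℝ)+k+1) + 1 := by field_simp; ring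
      rw [h5]
      refine h4.trans (Real.exp_le_exp.2 ?_)
      rw [neg_div, neg_div]; linarith

lemma ph_upper (n : ℕ) (hn : 1 ≤ n) (k : ℤ) :
    ph n k ≤ Real.exp (-((k:ℝ)/Real.sqrt n)^2/2) := by
  by_cases h : (n:ℤ) < |k|
  · rw [ph_support n k h]; exact Real.exp_nonneg _
  · have h' : k.natAbs ≤ n := by
      rw [Int.abs_eq_natAbs] at h; omega
    rw [ph_abs]
    refine (ph_bounds n n le_rfl _ h').2.trans (le_of_eq ?_)
    congr 1
    rw [div_pow, Real.sq_sqrt (Nat.cast_nonneg n), Nat.cast_natAbs, Int.cast_abs, sq_abs]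
    have : (0:ℝ) < n := by exact_mod_cast hn
    field_simp
    ring

lemma Nb_rec (n m : ℕ) : ∀ k : ℤ, ((n:ℝ)+k+1+m) * Nb (ph n) (m+1) k =
    (2*(k:ℝ)+1+m) * Nb (ph n) m k - 2*(m:ℝ) * Nb (ph n) (m-1) (k+1) := by
  induction m with
  | zero =>
    intro k
    have := ph_rec n k
    simp only [Nb]
    push_cast
    linarith
  | succ m ih =>
    intro k
    have a := ih k
    have b := ih (k+1)
    have hc : 2*(m:ℝ) * (Nb (ph n) (m-1) (k+1) - Nb (ph n) (m-1) (k+1+1)) =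
        2*(m:ℝ) * Nb (ph n) m (k+1) := by
      cases m with
      | zero => simp
      | succ m => rfl
    have e1 : Nb (ph n) (m+1+1) k = Nb (ph n) (m+1) k - Nb (ph n) (m+1) (k+1) := rfl
    have e2 : Nb (ph n) (m+1) k = Nb (ph n) m k - Nb (ph n) m (k+1) := rfl
    rw [e1]
    simp only [Nat.add_sub_cancel]
    push_cast at *
    linear_combination a - b - hc - (2*(k:ℝ)+1+m) * e2

lemma Nb_symm (n m : ℕ) : ∀ k : ℤ, Nb (ph n) m (-k-m) = (-1)^m * Nb (ph n) m k := by
  induction m with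
  | zero => intro k; simp [Nb, ph_even]
  | succ m ih =>
    intro k
    have a := ih k
    have b := ih (k+1)
    simp only [Nb]
    rw [show -k - ((m+1:ℕ):ℤ) + 1 = -k-m by push_cast; ring,
      show -k - ((m+1:ℕ):ℤ) = -(k+1)-m by push_cast; ring, a, b]
    rw [pow_succ]; ring

lemma DD_rec (n m : ℕ) (hn : 1 ≤ n) (k : ℤ) :
    (1 + ((k:ℝ)+1+m)/n) * DD n (m+1) k =
    ((2*(k:ℝ)+1+m)/Real.sqrt n) * DD n m k - 2*(m:ℝ) * DD n (m-1) (k+1) := by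
  have h := Nb_rec n m k
  have hn0 : (0:ℝ) < n := by exact_mod_cast hn
  have hq : 0 < Real.sqrt n := Real.sqrt_pos.2 hn0
  have hq2 : (Real.sqrt n)^2 = n := Real.sq_sqrt hn0.le
  unfold DD
  have e3 : 2*(m:ℝ) * ((Real.sqrt n)^(m-1) * Nb (ph n) (m-1) (k+1)) =
      (Real.sqrt n)^(m+1)/n * (2*(m:ℝ) * Nb (ph n) (m-1) (k+1)) := by
    cases m with
    | zero => simp
    | succ m =>
      simp only [Nat.add_sub_cancel]
      rw [pow_succ, pow_succ]
      field_simp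
      rw [hq2]
  have e2 : ((2*(k:ℝ)+1+m)/Real.sqrt n) * ((Real.sqrt n)^m * Nb (ph n) m k) =
      (Real.sqrt n)^(m+1)/n * ((2*(k:ℝ)+1+m) * Nb (ph n) m k) := by
    rw [pow_succ]
    field_simp
    rw [hq2]
    ring
  rw [e2, e3, ← mul_sub, ← h]
  field_simp
  ring

lemma peetre (a b : ℝ) : 1 + |a+b| ≤ (1+|a|)*(1+|b|) := by
  have := abs_add_le a b
  have := abs_nonneg a
  have := abs_nonneg b
  nlinarith [mul_nonneg (abs_nonneg a) (abs_nonneg b)]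

lemma shift_bound (q : ℝ) (hq : 1 ≤ q) (k l : ℤ) (M : ℕ) (hl : |l - k| ≤ M) (A : ℕ) :
    (1+|(k:ℝ)/q|)^A ≤ ((M:ℝ)+1)^A * (1+|(l:ℝ)/q|)^A := by
  rw [← mul_pow]
  apply pow_le_pow_left₀ (by positivity)
  have h := peetre ((l:ℝ)/q) (((k:ℝ)-l)/q)
  rw [← add_div, add_sub_cancel] at h
  have h2 : |((k:ℝ)-l)/q| ≤ M := by
    rw [abs_div, abs_of_pos (by linarith : 0 < q), abs_sub_comm]
    have : |(l:ℝ)-k| ≤ M := by exact_mod_cast hl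
    calc _ ≤ |(l:ℝ)-k| / 1 := by
            apply div_le_div_of_nonneg_left (abs_nonneg _) one_pos hq
      _ ≤ M := by simpa using this
  have h3 : 0 ≤ 1 + |(l:ℝ)/q| := by positivity
  nlinarith

lemma DD_bound (m : ℕ) : ∀ A : ℕ, ∃ C : ℝ, 0 ≤ C ∧ ∀ n : ℕ, 1 ≤ n → ∀ k : ℤ,
    |DD n m k| * (1+|(k:ℝ)/Real.sqrt n|)^A ≤ C := by
  induction m using Nat.strong_induction_on with
  | _ m ih =>
  intro A
  cases m with
  | zero =>
    refine ⟨Real.exp ((A:ℝ)^2/2), Real.exp_nonneg _, fun n hn k => ?_⟩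
    simp only [DD, Nb, pow_zero, one_mul]
    rw [abs_of_nonneg (ph_nonneg _ _)]
    set x := (k:ℝ)/Real.sqrt n with hx
    have h1 := ph_upper n hn k
    rw [← hx] at h1
    have h2 : (1+|x|)^A ≤ Real.exp (A*|x|) := by
      rw [Real.exp_nat_mul]
      apply pow_le_pow_left₀ (by positivity)
      have := Real.add_one_le_exp |x|
      linarith
    calc _ ≤ Real.exp (-x^2/2) * Real.exp (A*|x|) := by
            apply mul_le_mul h1 h2 (by positivity) (Real.exp_nonneg _)
      _ ≤ _ := by
            rw [← Real.exp_add]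
            apply Real.exp_le_exp.2
            rw [← sq_abs x]
            nlinarith [sq_nonneg (|x| - A)]
  | succ m =>
    obtain ⟨C1, hC1, h1⟩ := ih m (by omega) (A+1)
    obtain ⟨C2, hC2, h2⟩ := ih (m-1) (by omega) A
    set C' : ℝ := (3+m)*C1 + 2*m*(2^A*C2) with hC'
    have hC'0 : 0 ≤ C' := by positivity
    have main : ∀ n : ℕ, 1 ≤ n → ∀ k : ℤ, -((m:ℤ)+1) ≤ k →
        |DD n (m+1) k| * (1+|(k:ℝ)/Real.sqrt n|)^A ≤ C' := by
      intro n hn k hk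
      have hn0 : (1:ℝ) ≤ n := by exact_mod_cast hn
      have hq : 1 ≤ Real.sqrt n := Real.one_le_sqrt.2 hn0
      have hr := DD_rec n m hn k
      set q := Real.sqrt n
      have hk' : 0 ≤ ((k:ℝ)+1+m) := by
        have : -((m:ℝ)+1) ≤ k := by exact_mod_cast hk
        linarith
      have hge : |DD n (m+1) k| ≤ |(1 + ((k:ℝ)+1+m)/n) * DD n (m+1) k| := by
        rw [abs_mul]
        apply le_mul_of_one_le_left (abs_nonneg _)
        have : 0 ≤ ((k:ℝ)+1+m)/n := by positivity
        rw [abs_of_nonneg (by linarith)]; linarith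
      rw [hr] at hge
      have hcoef : |(2*(k:ℝ)+1+m)/q| ≤ (3+m) * (1+|(k:ℝ)/q|) := by
        have e : (2*(k:ℝ)+1+m)/q = 2*((k:ℝ)/q) + (1+m)/q := by field_simp; ring
        rw [e]
        have a1 := abs_add_le (2*((k:ℝ)/q)) ((1+m)/q)
        rw [abs_mul, abs_two, abs_of_nonneg (by positivity : 0 ≤ (1+(m:ℝ))/q)] at a1
        have a2 : (1+(m:ℝ))/q ≤ 1+m := div_le_self (by positivity) hq
        have a3 := abs_nonneg ((k:ℝ)/q)
        have a4 : (0:ℝ) ≤ m := Nat.cast_nonneg m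
        nlinarith [mul_nonneg a4 a3]
      have b1 := h1 n hn k
      have b2 := h2 n hn (k+1)
      have b3 := shift_bound q hq k (k+1) 1 (by simp) A
      have hge2 : |DD n (m+1) k| ≤ (3+m) * (1+|(k:ℝ)/q|) * |DD n m k| + 2*m*|DD n (m-1) (k+1)| := by
        refine hge.trans ((abs_sub _ _).trans ?_)
        rw [abs_mul, abs_mul, abs_of_nonneg (by positivity : (0:ℝ) ≤ 2*m)]
        gcongr
      calc _ ≤ ((3+m) * (1+|(k:ℝ)/q|) * |DD n m k| + 2*m*|DD n (m-1) (k+1)|) * (1+|(k:ℝ)/q|)^A := by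
            gcongr
        _ = (3+m)*(|DD n m k| * (1+|(k:ℝ)/q|)^(A+1)) + 2*m*(|DD n (m-1) (k+1)| * (1+|(k:ℝ)/q|)^A) := by
            ring
        _ ≤ (3+m)*C1 + 2*m*(|DD n (m-1) (k+1)| * ((((1:ℕ):ℝ)+1)^A * (1+|((k+1:ℤ):ℝ)/q|)^A)) := by
            gcongr
        _ = (3+m)*C1 + 2*m*(2^A * (|DD n (m-1) (k+1)| * (1+|((k+1:ℤ):ℝ)/q|)^A)) := by
            push_cast; ring
        _ ≤ C' := by
            rw [hC']
            gcongr
    refine ⟨((m+2:ℝ))^A * C', by positivity, fun n hn k => ?_⟩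
    have hone : (1:ℝ) ≤ ((m+2:ℝ))^A := one_le_pow₀ (by have : (0:ℝ) ≤ m := Nat.cast_nonneg m
                                                       linarith)
    by_cases hk : -((m:ℤ)+1) ≤ k
    · refine (main n hn k hk).trans ?_
      nlinarith
    · have hs := Nb_symm n (m+1) k
      set k' := -k-((m+1:ℕ):ℤ) with hk'
      have hk'0 : 0 < k' := by push_cast at hk'; omega
      have hn0 : (1:ℝ) ≤ n := by exact_mod_cast hn
      have hq : 1 ≤ Real.sqrt n := Real.one_le_sqrt.2 hn0
      have e1 : |DD n (m+1) k| = |DD n (m+1) k'| := by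
        unfold DD
        rw [hs, abs_mul, abs_mul, abs_mul, abs_pow (-1:ℝ)]
        simp
      have e2 := main n hn k' (by omega)
      have e3 := shift_bound (Real.sqrt n) hq (-k) k' (m+1) (by
        rw [hk']; rw [show -k - ((m+1:ℕ):ℤ) - -k = -((m+1:ℕ):ℤ) by ring, abs_neg]
        rw [abs_of_nonneg (by positivity)]) A
      rw [Int.cast_neg, neg_div, abs_neg] at e3
      rw [e1]
      calc _ ≤ |DD n (m+1) k'| * ((((m+1:ℕ):ℝ)+1)^A * (1+|(k':ℝ)/Real.sqrt n|)^A) := by gcongr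
        _ = (m+2:ℝ)^A * (|DD n (m+1) k'| * (1+|(k':ℝ)/Real.sqrt n|)^A) := by
            push_cast; ring
        _ ≤ _ := by gcongr

lemma sqrt_atTop : Tendsto (fun n : ℕ => Real.sqrt n) atTop atTop :=
  Real.tendsto_sqrt_atTop.comp tendsto_natCast_atTop_atTop

lemma ph_tendsto (k : ℕ → ℤ) (x : ℝ)
    (hk : Tendsto (fun n : ℕ => (k n : ℝ)/Real.sqrt n) atTop (𝓝 x)) :
    Tendsto (fun n => ph n (k n)) atTop (𝓝 (Real.exp (-x^2))) := by
  set a : ℕ → ℕ := fun n => (k n).natAbs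
  have ha : Tendsto (fun n : ℕ => (a n : ℝ)/Real.sqrt n) atTop (𝓝 |x|) := by
    refine hk.abs.congr fun n => ?_
    rw [abs_div, abs_of_nonneg (Real.sqrt_nonneg _)]
    simp [a, Nat.cast_natAbs]
  have hinv : Tendsto (fun n : ℕ => (Real.sqrt n)⁻¹) atTop (𝓝 0) :=
    tendsto_inv_atTop_zero.comp sqrt_atTop
  have hinv2 : Tendsto (fun n : ℕ => ((n:ℝ))⁻¹) atTop (𝓝 0) :=
    tendsto_inv_atTop_zero.comp tendsto_natCast_atTop_atTop
  have han : Tendsto (fun n : ℕ => (a n : ℝ)/n) atTop (𝓝 0) := by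
    have := ha.mul hinv
    rw [mul_zero] at this
    refine this.congr fun n => ?_
    rw [div_eq_mul_inv, mul_assoc, ← mul_inv, Real.mul_self_sqrt (Nat.cast_nonneg n), div_eq_mul_inv]
  have hle : ∀ᶠ n in atTop, a n ≤ n := by
    filter_upwards [han.eventually (gt_mem_nhds one_pos), eventually_ge_atTop 1] with n h1 h2
    have : (0:ℝ) < n := by exact_mod_cast h2
    rw [div_lt_one this] at h1
    exact_mod_cast h1.le
  have hlow : Tendsto (fun n : ℕ => Real.exp (-((a n:ℝ)/Real.sqrt n)^2/(1 - (a n:ℝ)/n + ((n:ℝ))⁻¹)))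
      atTop (𝓝 (Real.exp (-x^2))) := by
    have : Tendsto (fun n : ℕ => (-((a n:ℝ)/Real.sqrt n)^2/(1 - (a n:ℝ)/n + ((n:ℝ))⁻¹)))
      atTop (𝓝 (-|x|^2/(1 - 0 + 0))) :=
      (ha.pow 2).neg.div ((tendsto_const_nhds.sub han).add hinv2) (by norm_num)
    have h2 := (Real.continuous_exp.tendsto _).comp this
    simpa [Function.comp_def] using h2
  have hup : Tendsto (fun n : ℕ => Real.exp (-((a n:ℝ)/Real.sqrt n)^2/(1 + (a n:ℝ)/n)))
      atTop (𝓝 (Real.exp (-x^2))) := by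
    have : Tendsto (fun n : ℕ => (-((a n:ℝ)/Real.sqrt n)^2/(1 + (a n:ℝ)/n)))
      atTop (𝓝 (-|x|^2/(1 + 0))) :=
      (ha.pow 2).neg.div (tendsto_const_nhds.add han) (by norm_num)
    have h2 := (Real.continuous_exp.tendsto _).comp this
    simpa [Function.comp_def] using h2
  refine tendsto_of_tendsto_of_tendsto_of_le_of_le' hlow hup ?_ ?_
  · filter_upwards [hle, eventually_ge_atTop 1] with n h1 h2
    rw [ph_abs]
    refine le_trans (le_of_eq ?_) (ph_bounds n (a n) h1 (a n) le_rfl).1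
    have hn0 : (0:ℝ) < n := by exact_mod_cast h2
    have h1' : (a n:ℝ) ≤ n := by exact_mod_cast h1
    congr 1
    rw [div_pow, Real.sq_sqrt hn0.le]
    have : (n:ℝ) - a n + 1 ≠ 0 := by linarith
    field_simp
  · filter_upwards [hle, eventually_ge_atTop 1] with n h1 h2
    rw [ph_abs]
    refine le_trans (ph_bounds n (a n) h1 (a n) le_rfl).2 (le_of_eq ?_)
    have hn0 : (0:ℝ) < n := by exact_mod_cast h2
    congr 1
    rw [div_pow, Real.sq_sqrt hn0.le]
    field_simp

lemma shift_tendsto (k : ℕ → ℤ) (x : ℝ) (c : ℤ)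
    (hk : Tendsto (fun n : ℕ => (k n : ℝ)/Real.sqrt n) atTop (𝓝 x)) :
    Tendsto (fun n : ℕ => ((k n + c : ℤ) : ℝ)/Real.sqrt n) atTop (𝓝 x) := by
  have hinv : Tendsto (fun n : ℕ => (Real.sqrt n)⁻¹) atTop (𝓝 0) :=
    tendsto_inv_atTop_zero.comp sqrt_atTop
  have := hk.add (hinv.const_mul (c:ℝ))
  rw [mul_zero, add_zero] at this
  refine this.congr fun n => ?_
  push_cast
  ring

lemma DD_tendsto (m : ℕ) : ∀ (k : ℕ → ℤ) (x : ℝ)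
    (_ : Tendsto (fun n : ℕ => (k n : ℝ)/Real.sqrt n) atTop (𝓝 x)),
    Tendsto (fun n => DD n m (k n)) atTop (𝓝 (GG m x)) := by
  induction m using Nat.strong_induction_on with
  | _ m ih =>
  intro k x hk
  cases m with
  | zero =>
    simpa [DD, Nb, GG_zero] using ph_tendsto k x hk
  | succ m =>
    have t1 := ih m (by omega) k x hk
    have t2 := ih (m-1) (by omega) (fun n => k n + 1) x (shift_tendsto k x 1 hk)
    have hinv : Tendsto (fun n : ℕ => (Real.sqrt n)⁻¹) atTop (𝓝 0) :=
      tendsto_inv_atTop_zero.comp sqrt_atTop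
    have c1 : Tendsto (fun n : ℕ => (2*(k n:ℝ)+1+m)/Real.sqrt n) atTop (𝓝 (2*x)) := by
      have := (hk.const_mul 2).add (hinv.const_mul ((1:ℝ)+m))
      rw [mul_zero, add_zero] at this
      refine this.congr fun n => ?_
      ring
    have c2 : Tendsto (fun n : ℕ => 1 + ((k n:ℝ)+1+m)/n) atTop (𝓝 1) := by
      have := (shift_tendsto k x (1+m) hk).mul hinv
      rw [mul_zero] at this
      have := (tendsto_const_nhds (x := (1:ℝ))).add this
      rw [add_zero] at this
      refine this.congr fun n => ?_
      rw [div_eq_mul_inv, mul_assoc, ← mul_inv, Real.mul_self_sqrt (Nat.cast_nonneg n)]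
      push_cast
      ring
    have t3 := ((c1.mul t1).sub (t2.const_mul (2*(m:ℝ)))).div c2 one_ne_zero
    rw [div_one, ← GG_rec] at t3
    refine t3.congr' ?_
    filter_upwards [c2.eventually (lt_mem_nhds (zero_lt_one)), eventually_ge_atTop 1] with n h1 h2
    simp only [Pi.div_apply]
    rw [← DD_rec n m h2 (k n)]
    exact mul_div_cancel_left₀ _ h1.ne'

lemma Nb_neg (h : ℤ → ℝ) (i : ℕ) : ∀ x : ℤ, Nb (fun y => h (-y)) i x = (-1)^i * Nb h i (-x-i) := by
  induction i with
  | zero => intro x; simp [Nb]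
  | succ i ih =>
    intro x
    simp only [Nb]
    rw [ih, ih, show -(x+1)-(i:ℤ) = -x-((i+1:ℕ):ℤ) by push_cast; ring,
      show -x-((i+1:ℕ):ℤ)+1 = -x-(i:ℤ) by push_cast; ring, pow_succ]
    ring

lemma Nb_Nb (f : ℤ → ℝ) (i j : ℕ) : ∀ x : ℤ, Nb (fun y => Nb f j y) i x = Nb f (i+j) x := by
  induction i with
  | zero => intro x; simp [Nb]
  | succ i ih =>
    intro x
    rw [show i+1+j = (i+j)+1 by ring]
    simp only [Nb]
    rw [ih, ih]

lemma Nb_sub (f g : ℤ → ℝ) (i : ℕ) : ∀ x : ℤ, Nb (fun y => f y - g y) i x = Nb f i x - Nb g i x := by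
  induction i with
  | zero => intro x; simp [Nb]
  | succ i ih =>
    intro x
    simp only [Nb]
    rw [ih, ih]; ring

lemma Nb_shift (f : ℤ → ℝ) (c : ℤ) (i : ℕ) : ∀ x : ℤ, Nb (fun y => f (y + c)) i x = Nb f i (x+c) := by
  induction i with
  | zero => intro x; simp [Nb]
  | succ i ih =>
    intro x
    simp only [Nb]
    rw [ih, ih]
    congr 2; ring

lemma Nb_fwd (f : ℤ → ℝ) (m : ℕ) : ∀ x : ℤ, Nb f m x = (-1)^m * (fwdDiff (1:ℤ))^[m] f x := by
  induction m with
  | zero => intro x; simp [Nb]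
  | succ m ih =>
    intro x
    simp only [Nb]
    rw [ih, ih, Function.iterate_succ_apply', fwdDiff, pow_succ]
    ring

lemma Nb_sum (f : ℤ → ℝ) (p : ℕ) (m : Fin p) (x : ℤ) :
    ∑ j : Fin p, ((-1:ℝ)^(j:ℕ) * (((m:ℕ).choose j : ℕ) : ℝ)) * f (x + (j:ℕ)) = Nb f m x := by
  rw [Nb_fwd, fwdDiff_iter_eq_sum_shift, Finset.mul_sum,
    Fin.sum_univ_eq_sum_range (fun j : ℕ => ((-1:ℝ)^j * (((m:ℕ).choose j : ℕ) : ℝ)) * f (x + j)) p]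
  symm
  have hsub : Finset.range ((m:ℕ)+1) ⊆ Finset.range p := by
    intro a ha; simp at *; omega
  rw [← Finset.sum_subset hsub]
  · refine Finset.sum_congr rfl fun k hk => ?_
    have hk' : k ≤ m := by simp at hk; omega
    simp only [zsmul_eq_mul, nsmul_eq_mul, mul_one]
    push_cast
    obtain ⟨d, hd⟩ := Nat.exists_eq_add_of_le hk'
    have : (-1:ℝ)^(m:ℕ) * (-1:ℝ)^((m:ℕ)-k) = (-1)^k := by
      rw [hd, Nat.add_sub_cancel_left, pow_add, mul_assoc, ← mul_pow]; norm_num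
    rw [← this]
    ring
  · intro k _ hk
    have : (m:ℕ) < k := by simp at hk; omega
    rw [Nat.choose_eq_zero_of_lt this]; simp

lemma det_ops (p : ℕ) (f g : ℤ → ℝ) (s : ℤ) :
    Matrix.det (Matrix.of fun i j : Fin p => f ((j:ℕ) - (i:ℕ)) - g ((j:ℕ) + (i:ℕ) + s)) =
    Matrix.det (Matrix.of fun i j : Fin p =>
      (-1:ℝ)^(i:ℕ) * Nb f ((i:ℕ)+(j:ℕ)) (-(i:ℕ)) - Nb g ((i:ℕ)+(j:ℕ)) s) := by
  set L : Matrix (Fin p) (Fin p) ℝ := Matrix.of fun i j : Fin p =>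
    (-1:ℝ)^(j:ℕ) * (((i:ℕ).choose j : ℕ) : ℝ) with hL
  have hdet : L.det * L.det = 1 := by
    have : L.det = ∏ i, L i i := by
      apply Matrix.det_of_isLowerTriangular
      intro i j hij
      simp only [hL, Matrix.of_apply]
      have hij' : i < j := by simpa using hij
      rw [Nat.choose_eq_zero_of_lt hij']; simp
    rw [this, ← Finset.prod_mul_distrib]
    apply Finset.prod_eq_one
    intro i _
    simp only [hL, Matrix.of_apply, Nat.choose_self]
    rw [mul_mul_mul_comm, ← mul_pow]; norm_num
  set M := (Matrix.of fun i j : Fin p => f ((j:ℕ) - (i:ℕ)) - g ((j:ℕ) + (i:ℕ) + s))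
  have : M.det = (L * (M * L.transpose)).det := by
    rw [Matrix.det_mul, Matrix.det_mul, Matrix.det_transpose, mul_comm M.det, ← mul_assoc, hdet, one_mul]
  rw [this]
  congr 1
  ext i j
  rw [Matrix.mul_apply]
  have h1 : ∀ i' : Fin p, (M * L.transpose) i' j = Nb f j (-(i':ℕ)) - Nb g j (s + (i':ℕ)) := by
    intro i'
    rw [Matrix.mul_apply, ← Nb_sum, ← Nb_sum, ← Finset.sum_sub_distrib]
    refine Finset.sum_congr rfl fun k _ => ?_
    simp only [M, hL, Matrix.of_apply, Matrix.transpose_apply]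
    rw [show ((k:ℕ):ℤ) - (i':ℕ) = -(i':ℕ) + (k:ℕ) by ring,
      show ((k:ℕ):ℤ) + (i':ℕ) + s = s + (i':ℕ) + (k:ℕ) by ring]
    ring
  simp only [h1]
  have h2 := Nb_sum (fun y => Nb f j (-y)) p i 0
  have h3 := Nb_sum (fun y => Nb g j y) p i s
  rw [Nb_Nb] at h3
  rw [Nb_neg (fun y => Nb f j y), Nb_Nb] at h2
  simp only [zero_add, neg_zero, zero_sub] at h2
  simp only [Matrix.of_apply]
  rw [← h2, ← h3, ← Finset.sum_sub_distrib]
  refine Finset.sum_congr rfl fun k _ => ?_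
  simp only [hL, Matrix.of_apply]
  ring

noncomputable def EE (n m : ℕ) (W s : ℤ) : ℝ := ∑' ℓ : ℤ, DD n m (s + ℓ*W)

lemma Nb_summable (n m : ℕ) (W : ℤ) (hW : 1 ≤ W) : ∀ k : ℤ,
    Summable (fun ℓ : ℤ => Nb (ph n) m (k + ℓ*W)) := by
  induction m with
  | zero =>
    intro k
    have := (PB_summable (2*n) W (2*k) hW).div_const (Bw (2*n) 0)
    refine this.congr fun ℓ => ?_
    simp only [Nb, ph]
    congr 2; ring
  | succ m ih =>
    intro k
    refine ((ih k).sub (ih (k+1))).congr fun ℓ => ?_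
    simp only [Nb]
    congr 2; ring

lemma DD_summable (n m : ℕ) (W : ℤ) (hW : 1 ≤ W) (k : ℤ) :
    Summable (fun ℓ : ℤ => DD n m (k + ℓ*W)) := (Nb_summable n m W hW k).mul_left _

noncomputable def fW (n : ℕ) (W k : ℤ) : ℝ := ∑' ℓ : ℤ, ph n (k + ℓ*W)

lemma Nb_fW (n m : ℕ) (W : ℤ) (hW : 1 ≤ W) : ∀ k : ℤ,
    Nb (fW n W) m k = ∑' ℓ : ℤ, Nb (ph n) m (k + ℓ*W) := by
  induction m with
  | zero => intro k; rfl
  | succ m ih =>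
    intro k
    simp only [Nb]
    rw [ih, ih, ← (Nb_summable n m W hW k).tsum_sub (Nb_summable n m W hW _)]
    refine tsum_congr fun ℓ => ?_
    congr 2; ring

lemma EE_eq (n m : ℕ) (W : ℤ) (hW : 1 ≤ W) (k : ℤ) :
    EE n m W k = Real.sqrt n ^ m * Nb (fW n W) m k := by
  rw [Nb_fW n m W hW, ← tsum_mul_left]; rfl

lemma PB_fW (n : ℕ) (W k : ℤ) : PB (2*n) W (2*k) = Bw (2*n) 0 * fW n W k := by
  unfold PB fW
  rw [← tsum_mul_left]
  refine tsum_congr fun ℓ => ?_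
  unfold ph
  rw [mul_div_cancel₀ _ (by simpa using (Bw_pos n).ne')]
  congr 1; ring

noncomputable def MM (p n : ℕ) (W s : ℤ) : Matrix (Fin p) (Fin p) ℝ :=
  Matrix.of fun i j : Fin p =>
    (-1:ℝ)^(i:ℕ) * EE n ((i:ℕ)+(j:ℕ)) W (-(i:ℕ)) - EE n ((i:ℕ)+(j:ℕ)) W s

noncomputable def TT (p n : ℕ) : Matrix (Fin p) (Fin p) ℝ :=
  Matrix.of fun i j : Fin p => (-1:ℝ)^(i:ℕ) * DD n ((i:ℕ)+(j:ℕ)) (-(i:ℕ))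

noncomputable def QQ (p n : ℕ) : ℝ := (∏ i : Fin p, Real.sqrt n ^ (i:ℕ)) * (∏ i : Fin p, Real.sqrt n ^ (i:ℕ))

lemma QQ_pos (p n : ℕ) (hn : 1 ≤ n) : 0 < QQ p n := by
  have : 0 < Real.sqrt n := Real.sqrt_pos.2 (by exact_mod_cast hn)
  unfold QQ
  positivity

lemma det_scale (p n : ℕ) (A B : Matrix (Fin p) (Fin p) ℝ)
    (h : ∀ i j, B i j = Real.sqrt n ^ ((i:ℕ)+(j:ℕ)) * A i j) : B.det = QQ p n * A.det := by
  have : B = Matrix.of fun i j : Fin p => Real.sqrt n ^ (i:ℕ) * (Matrix.of fun i j : Fin p => Real.sqrt n ^ (j:ℕ) * A i j) i j := by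
    ext i j
    rw [h, pow_add]; simp only [Matrix.of_apply]; ring
  rw [this, Matrix.det_mul_column, Matrix.det_mul_row, QQ]
  ring

lemma FF_eq (p n : ℕ) (W s : ℤ) (hW : 1 ≤ W) :
    QQ p n * FF p n W s = Bw (2*n) 0 ^ p * (MM p n W s).det := by
  have h1 : FF p n W s = Bw (2*n) 0 ^ p * Matrix.det (Matrix.of fun i j : Fin p =>
      fW n W ((j:ℕ) - (i:ℕ)) - fW n W ((j:ℕ) + (i:ℕ) + s)) := by
    have := Matrix.det_smul (Matrix.of fun i j : Fin p =>
      fW n W ((j:ℕ) - (i:ℕ)) - fW n W ((j:ℕ) + (i:ℕ) + s)) (Bw (2*n) 0)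
    rw [Fintype.card_fin] at this
    rw [← this, FF]
    congr 1
    ext i j
    simp only [Matrix.of_apply, Matrix.smul_apply, smul_eq_mul, mul_sub]
    rw [← PB_fW, ← PB_fW]
    congr 2 <;> ring
  rw [h1, det_ops, det_scale p n _ (MM p n W s)]
  · ring
  · intro i j
    simp only [MM, Matrix.of_apply, EE_eq _ _ _ hW]
    ring

lemma total_eq (p n : ℕ) :
    QQ p n * (Nat.card (melonIn p n Set.univ) : ℝ) = Bw (2*n) 0 ^ p * (TT p n).det := by
  have h1 : (Nat.card (melonIn p n Set.univ) : ℝ) = Bw (2*n) 0 ^ p * Matrix.det (Matrix.of fun i j : Fin p =>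
      ph n ((j:ℕ) - (i:ℕ)) - (fun _ : ℤ => (0:ℝ)) ((j:ℕ) + (i:ℕ) + 0)) := by
    have := Matrix.det_smul (Matrix.of fun i j : Fin p =>
      ph n ((j:ℕ) - (i:ℕ)) - (fun _ : ℤ => (0:ℝ)) ((j:ℕ) + (i:ℕ) + 0)) (Bw (2*n) 0)
    rw [Fintype.card_fin] at this
    rw [← this, total_card]
    congr 1
    ext i j
    simp only [Matrix.of_apply, Matrix.smul_apply, smul_eq_mul, sub_zero]
    unfold ph
    rw [mul_div_cancel₀ _ (by simpa using (Bw_pos n).ne')]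
    congr 1; ring
  have h0 : ∀ m (x : ℤ), Nb (fun _ : ℤ => (0:ℝ)) m x = 0 := by
    intro m
    induction m with
    | zero => intro x; rfl
    | succ m ih => intro x; simp [Nb, ih]
  rw [h1, det_ops p (ph n) (fun _ : ℤ => (0:ℝ)) 0, det_scale p n _ (TT p n)]
  · ring
  · intro i j
    simp only [TT, Matrix.of_apply, h0, DD]
    ring

lemma TT_tendsto (p : ℕ) : Tendsto (fun n => (TT p n).det) atTop
    (𝓝 ((2:ℝ)^(p.choose 2) * ∏ i ∈ Finset.range p, (i.factorial : ℝ))) := by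
  rw [← det_zero_eval]
  have : Tendsto (fun n => TT p n) atTop (𝓝 (Matrix.of fun i j : Fin p => (-1:ℝ)^(i:ℕ) * GG ((i:ℕ)+(j:ℕ)) 0)) := by
    refine tendsto_pi_nhds.2 fun i => tendsto_pi_nhds.2 fun j => ?_
    refine Tendsto.const_mul _ (DD_tendsto _ (fun _ => -(i:ℕ)) 0 ?_)
    have := shift_tendsto (fun _ => 0) 0 (-(i:ℕ)) (by simp)
    simpa using this
  exact ((Continuous.matrix_det continuous_id).tendsto _).comp this

lemma floor_tendsto (x : ℝ) (k : ℕ → ℤ) (hk : ∀ n, |(k n : ℝ) - x * Real.sqrt n| ≤ 1) :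
    Tendsto (fun n : ℕ => (k n : ℝ)/Real.sqrt n) atTop (𝓝 x) := by
  have hinv : Tendsto (fun n : ℕ => (Real.sqrt n)⁻¹) atTop (𝓝 0) :=
    tendsto_inv_atTop_zero.comp sqrt_atTop
  rw [tendsto_iff_norm_sub_tendsto_zero]
  refine squeeze_zero' (Eventually.of_forall fun _ => norm_nonneg _) ?_ hinv
  filter_upwards [eventually_ge_atTop 1] with n hn
  have hq : 0 < Real.sqrt n := Real.sqrt_pos.2 (by exact_mod_cast hn)
  have : (k n : ℝ)/Real.sqrt n - x = ((k n : ℝ) - x * Real.sqrt n) * (Real.sqrt n)⁻¹ := by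
    field_simp
  rw [this, Real.norm_eq_abs, abs_mul, abs_of_pos (inv_pos.2 hq)]
  exact mul_le_of_le_one_left (inv_pos.2 hq).le (hk n)

lemma floor_tendsto' (x : ℝ) :
    Tendsto (fun n : ℕ => ((⌊x * Real.sqrt n⌋ : ℤ) : ℝ)/Real.sqrt n) atTop (𝓝 x) := by
  refine floor_tendsto x _ fun n => ?_
  rw [abs_le]
  have := Int.floor_le (x * Real.sqrt n)
  have := Int.lt_floor_add_one (x * Real.sqrt n)
  constructor <;> linarith

lemma GG_bound (m A : ℕ) : ∃ C : ℝ, 0 ≤ C ∧ ∀ x : ℝ, |GG m x| * (1+|x|)^A ≤ C := by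
  obtain ⟨C, hC, h⟩ := DD_bound m A
  refine ⟨C, hC, fun x => ?_⟩
  have h1 := DD_tendsto m _ x (floor_tendsto' x)
  have h2 := h1.abs.mul (((floor_tendsto' x).abs.const_add 1).pow A)
  refine le_of_tendsto h2 ?_
  filter_upwards [eventually_ge_atTop 1] with n hn
  exact h n hn _

lemma wt_summable : Summable (fun ℓ : ℤ => (((1:ℝ)+|(ℓ:ℝ)|)^2)⁻¹) := by
  have h : Summable (fun n : ℕ => (((1:ℝ)+(n:ℝ))^2)⁻¹) := by
    have := (summable_nat_add_iff 1).2 (Real.summable_nat_pow_inv.2 (by norm_num : 1 < 2))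
    refine this.congr fun n => ?_
    push_cast; rw [add_comm]
  refine Summable.of_nat_of_neg ?_ ?_
  · simpa using h
  · simpa using h

noncomputable def ZZ : ℝ := ∑' ℓ : ℤ, (((1:ℝ)+|(ℓ:ℝ)|)^2)⁻¹

lemma ZZ_nonneg : 0 ≤ ZZ := tsum_nonneg fun _ => by positivity

/-- abstract decay transfer -/
lemma decay (S c : ℝ) (hS : 0 ≤ S) (hc : 0 < c) : ∃ K : ℝ, 0 ≤ K ∧
    ∀ (F C u v : ℝ) (ℓ : ℤ), 0 ≤ F → F * (1+|u+v|)^3 ≤ C → |u| ≤ S → c * |(ℓ:ℝ)| ≤ |v| →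
      F ≤ K * C * (((1:ℝ)+|(ℓ:ℝ)|)^3)⁻¹ := by
  set d := min 1 c with hd
  have hd0 : 0 < d := lt_min one_pos hc
  refine ⟨((1+S)/d)^3, by positivity, ?_⟩
  intro F C u v ℓ hF hFC hu hv
  have h1 : d * (1+|(ℓ:ℝ)|) ≤ (1+S)*(1+|u+v|) := by
    have h2 := peetre (u+v) (-u)
    rw [show u+v+-u = v by ring, abs_neg] at h2
    have h3 : d ≤ 1 := min_le_left _ _
    have h4 : d ≤ c := min_le_right _ _
    have h5 := mul_le_mul_of_nonneg_right h4 (abs_nonneg (ℓ:ℝ))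
    have h6 : (1+|u+v|)*(1+|u|) ≤ (1+|u+v|)*(1+S) :=
      mul_le_mul_of_nonneg_left (by linarith) (by positivity)
    linarith
  have h2 : (d * (1+|(ℓ:ℝ)|))^3 ≤ ((1+S)*(1+|u+v|))^3 := pow_le_pow_left₀ (by positivity) h1 3
  rw [mul_pow, mul_pow] at h2
  have hp : 0 < (1+|(ℓ:ℝ)|)^3 := by positivity
  rw [← div_eq_mul_inv, le_div_iff₀ hp, div_pow, div_mul_eq_mul_div, le_div_iff₀ (by positivity)]
  have h7 := mul_le_mul_of_nonneg_left h2 hF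
  have h8 := mul_le_mul_of_nonneg_left hFC (by positivity : 0 ≤ (1+S)^3)
  nlinarith

lemma wt32 (ℓ : ℤ) : |(ℓ:ℝ)| * (((1:ℝ)+|(ℓ:ℝ)|)^3)⁻¹ ≤ (((1:ℝ)+|(ℓ:ℝ)|)^2)⁻¹ := by
  have : 0 < 1+|(ℓ:ℝ)| := by positivity
  rw [← div_eq_mul_inv, div_le_iff₀ (by positivity)]
  field_simp
  linarith

lemma wt32' (ℓ : ℤ) : (((1:ℝ)+|(ℓ:ℝ)|)^3)⁻¹ ≤ (((1:ℝ)+|(ℓ:ℝ)|)^2)⁻¹ := by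
  apply inv_anti₀ (by positivity)
  apply pow_le_pow_right₀ _ (by norm_num)
  linarith [abs_nonneg (ℓ:ℝ)]

lemma DD_pos (m : ℕ) (S c : ℝ) (hS : 0 ≤ S) (hc : 0 < c) : ∃ C : ℝ, 0 ≤ C ∧
    ∀ n : ℕ, 1 ≤ n → ∀ s k ℓ : ℤ, |(s:ℝ)| ≤ S * Real.sqrt n →
      c * Real.sqrt n * |(ℓ:ℝ)| ≤ |(k:ℝ)| →
      |DD n m (s+k)| ≤ C * (((1:ℝ)+|(ℓ:ℝ)|)^3)⁻¹ := by
  obtain ⟨K, hK, h⟩ := decay S c hS hc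
  obtain ⟨C, hC, hb⟩ := DD_bound m 3
  refine ⟨K*C, by positivity, ?_⟩
  intro n hn s k ℓ hs hk
  have hq : 0 < Real.sqrt n := Real.sqrt_pos.2 (by exact_mod_cast hn)
  have hb' := hb n hn (s+k)
  push_cast at hb'
  rw [add_div] at hb'
  refine h _ _ _ _ ℓ (abs_nonneg _) hb' ?_ ?_
  · rw [abs_div, abs_of_pos hq, div_le_iff₀ hq]; exact hs
  · rw [abs_div, abs_of_pos hq, le_div_iff₀ hq]; linarith

lemma GG_pos (m : ℕ) (S c : ℝ) (hS : 0 ≤ S) (hc : 0 < c) : ∃ C : ℝ, 0 ≤ C ∧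
    ∀ (z w : ℝ) (ℓ : ℤ), |w| ≤ S → c ≤ z →
      |GG m ((ℓ:ℝ)*z+w)| ≤ C * (((1:ℝ)+|(ℓ:ℝ)|)^3)⁻¹ := by
  obtain ⟨K, hK, h⟩ := decay S c hS hc
  obtain ⟨C, hC, hb⟩ := GG_bound m 3
  refine ⟨K*C, by positivity, ?_⟩
  intro z w ℓ hw hz
  have hb' := hb (w + (ℓ:ℝ)*z)
  rw [add_comm ((ℓ:ℝ)*z)]
  refine h _ _ _ _ ℓ (abs_nonneg _) hb' hw ?_
  rw [abs_mul, abs_of_pos (hc.trans_le hz), mul_comm]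
  exact mul_le_mul_of_nonneg_left hz (abs_nonneg _)

lemma DD_tele (n m : ℕ) (a : ℤ) (j : ℕ) :
    Real.sqrt n * (DD n m a - DD n m (a+j)) = ∑ r ∈ Finset.range j, DD n (m+1) (a+r) := by
  induction j with
  | zero => simp
  | succ j ih =>
    rw [Finset.sum_range_succ, ← ih]
    unfold DD
    simp only [Nb]
    rw [show a + ((j+1:ℕ):ℤ) = a+j+1 by push_cast; ring, pow_succ]
    ring

noncomputable def DE (n m : ℕ) (W s ℓ : ℤ) : ℝ :=
  Real.sqrt n * (DD n m (s+ℓ*W) - DD n m (s+ℓ*(W-1)))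

lemma DE_pos (n m : ℕ) (W s : ℤ) (j : ℕ) :
    DE n m W s j = -∑ r ∈ Finset.range j, DD n (m+1) (s+((j:ℤ)*(W-1)+r)) := by
  have := DD_tele n m (s+(j:ℤ)*(W-1)) j
  simp only [← add_assoc]
  rw [← this, DE, show s + (j:ℤ)*(W-1)+j = s+(j:ℤ)*W by ring]
  ring

lemma DE_neg (n m : ℕ) (W s : ℤ) (j : ℕ) :
    DE n m W s (-(j:ℤ)) = ∑ r ∈ Finset.range j, DD n (m+1) (s+(-(j:ℤ)*W+r)) := by
  have := DD_tele n m (s+(-(j:ℤ))*W) j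
  simp only [← add_assoc]
  rw [← this, DE, show s + -(j:ℤ)*W+j = s+(-(j:ℤ))*(W-1) by ring]

lemma DE_bound (m : ℕ) (S c : ℝ) (hS : 0 ≤ S) (hc : 0 < c) : ∃ C : ℝ, 0 ≤ C ∧
    ∀ n : ℕ, 1 ≤ n → ∀ W s ℓ : ℤ, |(s:ℝ)| ≤ S * Real.sqrt n →
      c * Real.sqrt n ≤ (W:ℝ) - 1 →
      |DE n m W s ℓ| ≤ C * (((1:ℝ)+|(ℓ:ℝ)|)^2)⁻¹ := by
  obtain ⟨C, hC, h⟩ := DD_pos (m+1) S c hS hc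
  refine ⟨C, hC, ?_⟩
  intro n hn W s ℓ hs hW
  have hq : 0 < Real.sqrt n := Real.sqrt_pos.2 (by exact_mod_cast hn)
  have hW0 : 0 < (W:ℝ) - 1 := lt_of_lt_of_le (by positivity) hW
  refine le_trans ?_ (mul_le_mul_of_nonneg_left (wt32 ℓ) hC)
  rw [mul_left_comm]
  obtain ⟨j, rfl | rfl⟩ := Int.eq_nat_or_neg ℓ
  · rw [DE_pos, abs_neg]
    refine (Finset.abs_sum_le_sum_abs _ _).trans ?_
    refine (Finset.sum_le_card_nsmul _ _ (C * (((1:ℝ)+|((j:ℤ):ℝ)|)^3)⁻¹) fun r hr => ?_).trans ?_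
    · refine h n hn s _ j hs ?_
      push_cast
      rw [Nat.abs_cast, abs_of_nonneg (by positivity)]
      have := mul_le_mul_of_nonneg_right hW (Nat.cast_nonneg (α := ℝ) j)
      have : (0:ℝ) ≤ r := Nat.cast_nonneg r
      linarith
    · simp
  · rw [DE_neg]
    refine (Finset.abs_sum_le_sum_abs _ _).trans ?_
    refine (Finset.sum_le_card_nsmul _ _ (C * (((1:ℝ)+|((-(j:ℤ) : ℤ):ℝ)|)^3)⁻¹) fun r hr => ?_).trans ?_
    · refine h n hn s _ _ hs ?_
      push_cast
      have h3 : (r:ℝ) ≤ j := by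
        have := Finset.mem_range.1 hr
        exact_mod_cast this.le
      rw [abs_neg, Nat.abs_cast]
      have h4 := mul_le_mul_of_nonneg_right hW (Nat.cast_nonneg (α := ℝ) j)
      have := neg_le_abs (-(j:ℝ) * W + r)
      linarith
    · simp

lemma DD_bound2 (m : ℕ) (S c : ℝ) (hS : 0 ≤ S) (hc : 0 < c) : ∃ C : ℝ, 0 ≤ C ∧
    ∀ n : ℕ, 1 ≤ n → ∀ W s ℓ : ℤ, |(s:ℝ)| ≤ S * Real.sqrt n →
      c * Real.sqrt n ≤ (W:ℝ) →
      |DD n m (s+ℓ*W)| ≤ C * (((1:ℝ)+|(ℓ:ℝ)|)^2)⁻¹ := by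
  obtain ⟨C, hC, h⟩ := DD_pos m S c hS hc
  refine ⟨C, hC, ?_⟩
  intro n hn W s ℓ hs hW
  refine le_trans ?_ (mul_le_mul_of_nonneg_left (wt32' ℓ) hC)
  have hW0 : 0 ≤ (W:ℝ) := le_trans (by positivity) hW
  refine h n hn s _ ℓ hs ?_
  push_cast
  rw [abs_mul, abs_of_nonneg hW0, mul_comm]
  exact mul_le_mul_of_nonneg_left hW (abs_nonneg _)

lemma tsum_bd (f : ℤ → ℝ) (C : ℝ) (h : ∀ ℓ : ℤ, |f ℓ| ≤ C * (((1:ℝ)+|(ℓ:ℝ)|)^2)⁻¹) :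
    |∑' ℓ, f ℓ| ≤ C * ZZ := by
  unfold ZZ
  rw [← tsum_mul_left]
  exact tsum_of_norm_bounded (f := f) (wt_summable.mul_left C).hasSum h

lemma DE_tsum (n m : ℕ) (W s : ℤ) (hW : 1 ≤ W - 1) :
    ∑' ℓ, DE n m W s ℓ = Real.sqrt n * (EE n m W s - EE n m (W-1) s) := by
  unfold DE EE
  rw [tsum_mul_left, (DD_summable n m W (by omega) s).tsum_sub (DD_summable n m (W-1) hW s)]

lemma EE_bound (m : ℕ) (S c : ℝ) (hS : 0 ≤ S) (hc : 0 < c) : ∃ C : ℝ, 0 ≤ C ∧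
    ∀ n : ℕ, 1 ≤ n → ∀ W s : ℤ, |(s:ℝ)| ≤ S * Real.sqrt n →
      c * Real.sqrt n ≤ (W:ℝ) - 1 →
      |EE n m W s| ≤ C ∧ |EE n m (W-1) s| ≤ C ∧
      |Real.sqrt n * (EE n m W s - EE n m (W-1) s)| ≤ C := by
  obtain ⟨C1, hC1, h1⟩ := DD_bound2 m S c hS hc
  obtain ⟨C2, hC2, h2⟩ := DE_bound m S c hS hc
  have hZ := ZZ_nonneg
  refine ⟨(C1 + C2)*ZZ, by positivity, ?_⟩
  intro n hn W s hs hW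
  have hq : 0 < Real.sqrt n := Real.sqrt_pos.2 (by exact_mod_cast hn)
  have hW0 : 0 < (W:ℝ) - 1 := lt_of_lt_of_le (by positivity) hW
  have hW1 : 1 ≤ W - 1 := by
    have : (0:ℝ) < ((W-1 : ℤ):ℝ) := by push_cast; exact hW0
    have : 0 < W - 1 := by exact_mod_cast this
    omega
  have e1 : C1 * ZZ ≤ (C1+C2)*ZZ := by nlinarith
  have e2 : C2 * ZZ ≤ (C1+C2)*ZZ := by nlinarith
  refine ⟨le_trans (tsum_bd _ C1 fun ℓ => h1 n hn W s ℓ hs (by linarith)) e1,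
    le_trans (tsum_bd _ C1 fun ℓ => h1 n hn (W-1) s ℓ hs (by push_cast; linarith)) e1, ?_⟩
  rw [← DE_tsum n m W s hW1]
  exact le_trans (tsum_bd _ C2 fun ℓ => h2 n hn W s ℓ hs hW) e2

noncomputable def SG (m : ℕ) (z w : ℝ) : ℝ := ∑' ℓ : ℤ, GG m ((ℓ:ℝ)*z+w)
noncomputable def SG' (m : ℕ) (z w : ℝ) : ℝ := ∑' ℓ : ℤ, -GG (m+1) ((ℓ:ℝ)*z+w) * (ℓ:ℝ)

lemma SG_deriv (m : ℕ) (t w : ℝ) (ht : 0 < t) :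
    HasDerivAt (fun z => SG m z w) (SG' m t w) t := by
  obtain ⟨C1, hC1, h1⟩ := GG_pos (m+1) |w| (t/2) (abs_nonneg _) (by positivity)
  obtain ⟨C0, hC0, h0⟩ := GG_pos m |w| (t/2) (abs_nonneg _) (by positivity)
  unfold SG SG'
  refine hasDerivAt_tsum_of_isPreconnected (wt_summable.mul_left C1) (isOpen_Ioi (a := t/2))
    isPreconnected_Ioi (g := fun (ℓ : ℤ) z => GG m ((ℓ:ℝ)*z+w))
    (g' := fun (ℓ : ℤ) z => -GG (m+1) ((ℓ:ℝ)*z+w) * (ℓ:ℝ)) (y₀ := t) ?_ ?_ ?_ ?_ ?_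
  · intro ℓ y _
    have e : HasDerivAt (fun z : ℝ => (ℓ:ℝ)*z+w) (ℓ:ℝ) y := by
      simpa using ((hasDerivAt_id y).const_mul (ℓ:ℝ)).add_const w
    exact (GG_deriv m _).comp y e
  · intro ℓ y hy
    rw [norm_mul, norm_neg, Real.norm_eq_abs, Real.norm_eq_abs]
    refine le_trans ?_ (mul_le_mul_of_nonneg_left (wt32 ℓ) hC1)
    have := mul_le_mul_of_nonneg_right (h1 y w ℓ le_rfl (le_of_lt hy)) (abs_nonneg (ℓ:ℝ))
    linarith
  · simp; linarith
  · refine Summable.of_norm_bounded (wt_summable.mul_left C0) fun ℓ => ?_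
    refine (h0 t w ℓ le_rfl (by linarith)).trans ?_
    exact mul_le_mul_of_nonneg_left (wt32' ℓ) hC0
  · simp; linarith

/-- common hypotheses along a sequence -/
lemma seq_ev (W s : ℕ → ℤ) (t w : ℝ) (ht : 0 < t)
    (hW : Tendsto (fun n : ℕ => (W n : ℝ)/Real.sqrt n) atTop (𝓝 t))
    (hs : Tendsto (fun n : ℕ => (s n : ℝ)/Real.sqrt n) atTop (𝓝 w)) :
    ∀ᶠ n : ℕ in atTop, 1 ≤ n ∧ |(s n:ℝ)| ≤ (|w|+1) * Real.sqrt n ∧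
      (t/2) * Real.sqrt n ≤ (W n:ℝ) - 1 := by
  have hW1 := shift_tendsto W t (-1) hW
  filter_upwards [eventually_ge_atTop 1, hs.abs.eventually (gt_mem_nhds (lt_add_one |w|)),
    hW1.eventually (lt_mem_nhds (by linarith : t/2 < t))] with n hn h1 h2
  have hq : 0 < Real.sqrt n := Real.sqrt_pos.2 (by exact_mod_cast hn)
  rw [abs_div, abs_of_pos hq, div_lt_iff₀ hq] at h1
  rw [lt_div_iff₀ hq] at h2
  push_cast at h2
  exact ⟨hn, h1.le, by linarith⟩

lemma lin_tendsto (W s : ℕ → ℤ) (t w : ℝ) (ℓ : ℤ)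
    (hW : Tendsto (fun n : ℕ => (W n : ℝ)/Real.sqrt n) atTop (𝓝 t))
    (hs : Tendsto (fun n : ℕ => (s n : ℝ)/Real.sqrt n) atTop (𝓝 w)) :
    Tendsto (fun n : ℕ => ((s n + ℓ * W n : ℤ) : ℝ)/Real.sqrt n) atTop (𝓝 ((ℓ:ℝ)*t+w)) := by
  refine ((hW.const_mul (ℓ:ℝ)).add hs).congr fun n => ?_
  push_cast; ring

lemma EE_tendsto (m : ℕ) (W s : ℕ → ℤ) (t w : ℝ) (ht : 0 < t)
    (hW : Tendsto (fun n : ℕ => (W n : ℝ)/Real.sqrt n) atTop (𝓝 t))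
    (hs : Tendsto (fun n : ℕ => (s n : ℝ)/Real.sqrt n) atTop (𝓝 w)) :
    Tendsto (fun n => EE n m (W n) (s n)) atTop (𝓝 (SG m t w)) := by
  obtain ⟨C, hC, h⟩ := DD_bound2 m (|w|+1) (t/2) (by positivity) (by positivity)
  unfold EE SG
  refine tendsto_tsum_of_dominated_convergence (wt_summable.mul_left C) ?_ ?_
  · intro ℓ
    exact DD_tendsto m _ _ (lin_tendsto W s t w ℓ hW hs)
  · filter_upwards [seq_ev W s t w ht hW hs] with n hn ℓ
    exact h n hn.1 (W n) (s n) ℓ hn.2.1 (by linarith [hn.2.2])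

lemma DE_tendsto (m : ℕ) (W s : ℕ → ℤ) (t w : ℝ) (ht : 0 < t)
    (hW : Tendsto (fun n : ℕ => (W n : ℝ)/Real.sqrt n) atTop (𝓝 t))
    (hs : Tendsto (fun n : ℕ => (s n : ℝ)/Real.sqrt n) atTop (𝓝 w)) :
    Tendsto (fun n : ℕ => Real.sqrt n * (EE n m (W n) (s n) - EE n m (W n - 1) (s n))) atTop
      (𝓝 (SG' m t w)) := by
  obtain ⟨C, hC, h⟩ := DE_bound m (|w|+1) (t/2) (by positivity) (by positivity)
  have key : Tendsto (fun n => ∑' ℓ, DE n m (W n) (s n) ℓ) atTop (𝓝 (SG' m t w)) := by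
    unfold SG'
    refine tendsto_tsum_of_dominated_convergence (wt_summable.mul_left C) ?_ ?_
    · intro ℓ
      obtain ⟨j, rfl | rfl⟩ := Int.eq_nat_or_neg ℓ
      · simp only [DE_pos]
        have hh : -GG (m+1) (((j:ℤ):ℝ)*t+w) * ((j:ℤ):ℝ) =
            -∑ r ∈ Finset.range j, GG (m+1) (((j:ℤ):ℝ)*t+w) := by
          simp; ring
        rw [hh]
        refine (tendsto_finsetSum _ fun r _ => ?_).neg
        refine DD_tendsto (m+1) _ _ ?_
        have := shift_tendsto _ _ (r - j) (lin_tendsto W s t w j hW hs)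
        refine this.congr fun n => ?_
        push_cast; ring
      · simp only [DE_neg]
        have hh : -GG (m+1) (((-(j:ℤ) : ℤ):ℝ)*t+w) * ((-(j:ℤ) : ℤ):ℝ) =
            ∑ r ∈ Finset.range j, GG (m+1) (((-(j:ℤ) : ℤ):ℝ)*t+w) := by
          simp; ring
        rw [hh]
        refine (tendsto_finsetSum _ fun r _ => ?_)
        refine DD_tendsto (m+1) _ _ ?_
        have := shift_tendsto _ _ r (lin_tendsto W s t w (-(j:ℤ)) hW hs)
        refine this.congr fun n => ?_
        push_cast; ring
    · filter_upwards [seq_ev W s t w ht hW hs] with n hn ℓ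
      exact h n hn.1 (W n) (s n) ℓ hn.2.1 hn.2.2
  refine key.congr' ?_
  filter_upwards [seq_ev W s t w ht hW hs] with n hn
  have hq : 0 < Real.sqrt n := Real.sqrt_pos.2 (by exact_mod_cast hn.1)
  refine DE_tsum n m (W n) (s n) ?_
  have : (0:ℝ) < ((W n-1 : ℤ):ℝ) := by
    push_cast; exact lt_of_lt_of_le (by positivity) hn.2.2
  have : 0 < W n - 1 := by exact_mod_cast this
  omega

noncomputable def Dt (p : ℕ) (A : Fin p → Fin p → ℝ) : ℝ := Matrix.det (Matrix.of A)

lemma Dt_contDiff (p : ℕ) : ContDiff ℝ 1 (Dt p) := by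
  unfold Dt
  simp only [Matrix.det_apply']
  refine ContDiff.sum fun σ _ => contDiff_const.mul (contDiff_prod fun i _ => ?_)
  exact contDiff_apply_apply ℝ ℝ _ _

lemma Dt_lip (p : ℕ) (C : ℝ) : ∃ L : ℝ, 0 ≤ L ∧ ∀ X Y : Fin p → Fin p → ℝ,
    ‖X‖ ≤ C → ‖Y‖ ≤ C → |Dt p X - Dt p Y| ≤ L * ‖X - Y‖ := by
  have hc : Continuous (fderiv ℝ (Dt p)) := (Dt_contDiff p).continuous_fderiv one_ne_zero
  obtain ⟨L, hL⟩ := (isCompact_closedBall (0 : Fin p → Fin p → ℝ) C).exists_bound_of_continuousOn hc.continuousOn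
  refine ⟨max L 0, le_max_right _ _, fun X Y hX hY => ?_⟩
  refine (convex_closedBall (0 : Fin p → Fin p → ℝ) C).norm_image_sub_le_of_norm_fderiv_le
    (𝕜 := ℝ) (f := Dt p) (fun x _ => (Dt_contDiff p).differentiable one_ne_zero x)
    (fun x hx => (hL x hx).trans (le_max_left _ _)) ?_ ?_
  · simpa using hY
  · simpa using hX

lemma Dt_lim (p : ℕ) (q : ℕ → ℝ) (X Y : ℕ → Fin p → Fin p → ℝ) (A B : Fin p → Fin p → ℝ)
    (hX : Tendsto X atTop (𝓝 A)) (hY : Tendsto Y atTop (𝓝 A))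
    (hB : Tendsto (fun n => q n • (X n - Y n)) atTop (𝓝 B)) :
    Tendsto (fun n => q n * (Dt p (X n) - Dt p (Y n))) atTop (𝓝 (fderiv ℝ (Dt p) A B)) := by
  have hs : HasStrictFDerivAt (Dt p) (fderiv ℝ (Dt p) A) A :=
    (Dt_contDiff p).contDiffAt.hasStrictFDerivAt one_ne_zero
  have ho := hs.isLittleO.comp_tendsto (hX.prodMk_nhds hY)
  have ho2 : (fun n => q n * (Dt p (X n) - Dt p (Y n) - fderiv ℝ (Dt p) A (X n - Y n)))
      =o[atTop] (fun n => q n • (X n - Y n)) := by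
    have := (Asymptotics.isBigO_refl q atTop).smul_isLittleO ho
    simpa [Function.comp_def] using this
  have h0 : Tendsto (fun n => q n * (Dt p (X n) - Dt p (Y n) - fderiv ℝ (Dt p) A (X n - Y n))) atTop (𝓝 0) := by
    have hO : (fun n => q n • (X n - Y n)) =O[atTop] (fun _ => (1:ℝ)) := hB.isBigO_one ℝ
    exact (Asymptotics.isLittleO_one_iff ℝ).1 (ho2.trans_isBigO hO)
  have h1 := ((fderiv ℝ (Dt p) A).continuous.tendsto B).comp hB
  have := h0.add h1
  rw [zero_add] at this
  refine this.congr fun n => ?_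
  simp only [Function.comp_def, map_smul, smul_eq_mul]
  ring

noncomputable def AM (p : ℕ) (z w : ℝ) : Fin p → Fin p → ℝ := fun i j =>
  (-1:ℝ)^(i:ℕ) * SG ((i:ℕ)+(j:ℕ)) z 0 - SG ((i:ℕ)+(j:ℕ)) z w
noncomputable def BM (p : ℕ) (z w : ℝ) : Fin p → Fin p → ℝ := fun i j =>
  (-1:ℝ)^(i:ℕ) * SG' ((i:ℕ)+(j:ℕ)) z 0 - SG' ((i:ℕ)+(j:ℕ)) z w

lemma Tfun_eq (p : ℕ) (z w : ℝ) : Tfun p z w = Dt p (AM p z w) := by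
  unfold Tfun Dt AM SG GG
  simp only [add_zero]

lemma Tfun_deriv (p : ℕ) (t w : ℝ) (ht : 0 < t) :
    deriv (fun z => Tfun p z w) t = fderiv ℝ (Dt p) (AM p t w) (BM p t w) := by
  have h1 : HasDerivAt (fun z => AM p z w) (BM p t w) t := by
    refine hasDerivAt_pi.2 fun i => hasDerivAt_pi.2 fun j => ?_
    exact ((SG_deriv _ t 0 ht).const_mul _).sub (SG_deriv _ t w ht)
  have h2 : HasFDerivAt (Dt p) (fderiv ℝ (Dt p) (AM p t w)) (AM p t w) :=
    ((Dt_contDiff p).differentiable one_ne_zero _).hasFDerivAt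
  simp only [Tfun_eq]
  exact (h2.comp_hasDerivAt t h1).deriv

noncomputable def dl (p n : ℕ) (W s : ℤ) : ℝ :=
  Real.sqrt n * ((MM p n W s).det - (MM p n (W-1) s).det)

lemma MM_tendsto (p : ℕ) (W s : ℕ → ℤ) (t w : ℝ) (ht : 0 < t)
    (hW : Tendsto (fun n : ℕ => (W n : ℝ)/Real.sqrt n) atTop (𝓝 t))
    (hs : Tendsto (fun n : ℕ => (s n : ℝ)/Real.sqrt n) atTop (𝓝 w)) :
    Tendsto (fun n => (fun i j => MM p n (W n) (s n) i j)) atTop (𝓝 (AM p t w)) := by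
  refine tendsto_pi_nhds.2 fun i => tendsto_pi_nhds.2 fun j => ?_
  have h0 := shift_tendsto (fun _ => 0) 0 (-(i:ℕ)) (by simp)
  simp only [zero_add] at h0
  exact ((EE_tendsto _ W _ t 0 ht hW h0).const_mul _).sub (EE_tendsto _ W s t w ht hW hs)

lemma dl_tendsto (p : ℕ) (W s : ℕ → ℤ) (t w : ℝ) (ht : 0 < t)
    (hW : Tendsto (fun n : ℕ => (W n : ℝ)/Real.sqrt n) atTop (𝓝 t))
    (hs : Tendsto (fun n : ℕ => (s n : ℝ)/Real.sqrt n) atTop (𝓝 w)) :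
    Tendsto (fun n => dl p n (W n) (s n)) atTop (𝓝 (deriv (fun z => Tfun p z w) t)) := by
  rw [Tfun_deriv p t w ht]
  refine Dt_lim p (fun n => Real.sqrt n) (fun n i j => MM p n (W n) (s n) i j)
    (fun n i j => MM p n (W n - 1) (s n) i j) _ _ (MM_tendsto p W s t w ht hW hs)
    (MM_tendsto p (fun n => W n - 1) s t w ht (shift_tendsto W t (-1) hW) hs) ?_
  refine tendsto_pi_nhds.2 fun i => tendsto_pi_nhds.2 fun j => ?_
  have h0 := shift_tendsto (fun _ => 0) 0 (-(i:ℕ)) (by simp)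
  simp only [zero_add] at h0
  refine (((DE_tendsto _ W _ t 0 ht hW h0).const_mul _).sub (DE_tendsto _ W s t w ht hW hs)).congr fun n => ?_
  simp only [Pi.smul_apply, Pi.sub_apply, smul_eq_mul, MM, Matrix.of_apply]
  ring

lemma dl_bound (p : ℕ) (S c : ℝ) (hS : 0 ≤ S) (hc : 0 < c) : ∃ C : ℝ, 0 ≤ C ∧
    ∀ n : ℕ, 1 ≤ n → ∀ W s : ℤ, |(s:ℝ)| ≤ S * Real.sqrt n →
      c * Real.sqrt n ≤ (W:ℝ) - 1 → |dl p n W s| ≤ C := by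
  choose C hC h using fun m => EE_bound m (S+p) c (by positivity) hc
  set K := ∑ m ∈ Finset.range (2*p), C m with hK
  have hK0 : 0 ≤ K := Finset.sum_nonneg fun m _ => hC m
  have hCK : ∀ i j : Fin p, C ((i:ℕ)+(j:ℕ)) ≤ K := fun i j =>
    Finset.single_le_sum (f := C) (fun m _ => hC m) (Finset.mem_range.2 (by omega))
  obtain ⟨L, hL, hlip⟩ := Dt_lip p (2*K)
  refine ⟨L*(2*K), by positivity, ?_⟩
  intro n hn W s hs hW
  have hq : 1 ≤ Real.sqrt n := Real.one_le_sqrt.2 (by exact_mod_cast hn)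
  have hs' : |(s:ℝ)| ≤ (S+p) * Real.sqrt n := hs.trans
    (mul_le_mul_of_nonneg_right (by have : (0:ℝ) ≤ p := Nat.cast_nonneg p
                                    linarith) (by linarith))
  have hi : ∀ i : Fin p, |((-(i:ℕ) : ℤ):ℝ)| ≤ (S+p) * Real.sqrt n := by
    intro i
    have h1 : ((i:ℕ):ℝ) ≤ p := by exact_mod_cast i.2.le
    push_cast
    rw [abs_neg, Nat.abs_cast]
    nlinarith
  have comb : ∀ (i : ℕ) (a b k : ℝ), |a| ≤ k → |b| ≤ k → |(-1:ℝ)^i * a - b| ≤ 2*k := by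
    intro i a b k ha hb
    refine (abs_sub _ _).trans ?_
    rw [abs_mul, abs_pow, abs_neg, abs_one, one_pow, one_mul]
    linarith
  have hX : ‖(fun i j => MM p n W s i j)‖ ≤ 2*K := by
    refine (pi_norm_le_iff_of_nonneg (by positivity)).2 fun i => (pi_norm_le_iff_of_nonneg (by positivity)).2 fun j => ?_
    exact comb _ _ _ _ ((h _ n hn W _ (hi i) hW).1.trans (hCK i j)) ((h _ n hn W s hs' hW).1.trans (hCK i j))
  have hY : ‖(fun i j => MM p n (W-1) s i j)‖ ≤ 2*K := by
    refine (pi_norm_le_iff_of_nonneg (by positivity)).2 fun i => (pi_norm_le_iff_of_nonneg (by positivity)).2 fun j => ?_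
    exact comb _ _ _ _ ((h _ n hn W _ (hi i) hW).2.1.trans (hCK i j)) ((h _ n hn W s hs' hW).2.1.trans (hCK i j))
  have hXY : ‖Real.sqrt n • ((fun i j => MM p n W s i j) - (fun i j => MM p n (W-1) s i j))‖ ≤ 2*K := by
    refine (pi_norm_le_iff_of_nonneg (by positivity)).2 fun i => (pi_norm_le_iff_of_nonneg (by positivity)).2 fun j => ?_
    refine le_trans (le_of_eq ?_) (comb i _ _ _ ((h _ n hn W _ (hi i) hW).2.2.trans (hCK i j)) ((h _ n hn W s hs' hW).2.2.trans (hCK i j)))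
    rw [Real.norm_eq_abs]
    congr 1
    simp only [Pi.smul_apply, Pi.sub_apply, smul_eq_mul, MM, Matrix.of_apply]
    ring
  rw [norm_smul, Real.norm_eq_abs, abs_of_nonneg (by linarith)] at hXY
  have := hlip _ _ hX hY
  unfold dl
  rw [abs_mul, abs_of_nonneg (by linarith : 0 ≤ Real.sqrt n)]
  have h5 := mul_le_mul_of_nonneg_left this (by linarith : 0 ≤ Real.sqrt n)
  have h6 := mul_le_mul_of_nonneg_left hXY hL
  unfold Dt at h5
  refine h5.trans (le_trans (le_of_eq ?_) h6)
  ring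

lemma step_int1 (g : ℤ → ℝ) (s : ℕ) :
    IntervalIntegrable (fun u : ℝ => g ⌊u⌋) volume s ((s+1 : ℕ):ℝ) ∧
    ∫ u in (s:ℝ)..((s+1 : ℕ):ℝ), g ⌊u⌋ = g s := by
  have hle : (s:ℝ) ≤ ((s+1:ℕ):ℝ) := by push_cast; linarith
  have hae : ∀ᵐ u : ℝ, u ∈ Set.uIoc (s:ℝ) ((s+1:ℕ):ℝ) → g s = g ⌊u⌋ := by
    have : ∀ᵐ u : ℝ, u ≠ ((s+1:ℕ):ℝ) := by simp [ae_iff, measure_singleton]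
    filter_upwards [this] with u hu hm
    rw [Set.uIoc_of_le hle] at hm
    have h2 : u < ((s+1:ℕ):ℝ) := lt_of_le_of_ne hm.2 hu
    push_cast at h2
    congr 1
    symm
    rw [Int.floor_eq_iff]
    push_cast
    exact ⟨hm.1.le, h2⟩
  constructor
  · refine (intervalIntegrable_const (c := g s)).congr_ae ?_
    rw [Filter.EventuallyEq, ae_restrict_iff' measurableSet_uIoc]
    exact hae
  · rw [← intervalIntegral.integral_congr_ae hae]
    simp

lemma step_int (g : ℤ → ℝ) (q : ℝ) (hq : 0 < q) (W : ℕ) :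
    ∫ w in (0:ℝ)..(W/q), g ⌊w*q⌋ = q⁻¹ * ∑ s ∈ Finset.range W, g s := by
  rw [intervalIntegral.integral_comp_mul_right (fun u => g ⌊u⌋) hq.ne', zero_mul, div_mul_cancel₀ _ hq.ne',
    smul_eq_mul]
  congr 1
  have := intervalIntegral.sum_integral_adjacent_intervals (μ := volume) (f := fun u : ℝ => g ⌊u⌋)
    (a := fun s : ℕ => (s:ℝ)) (n := W) (fun k _ => (step_int1 g k).1)
  simp only [Nat.cast_zero] at this
  rw [← this]
  exact Finset.sum_congr rfl fun s _ => (step_int1 g s).2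

lemma int_tendsto (p : ℕ) (t : ℝ) (ht : 0 < t) :
    Tendsto (fun n : ℕ => ∫ w in (0:ℝ)..(((⌊t * Real.sqrt n⌋₊ + 1 : ℕ) : ℝ)/Real.sqrt n),
      dl p n ((⌊t * Real.sqrt n⌋₊ + 1 : ℕ) : ℤ) ⌊w * Real.sqrt n⌋) atTop
      (𝓝 (∫ w in (0:ℝ)..t, deriv (fun z => Tfun p z w) t)) := by
  set W : ℕ → ℤ := fun n => ((⌊t * Real.sqrt n⌋₊ + 1 : ℕ) : ℤ) with hWdef
  have hb : ∀ n : ℕ, t * Real.sqrt n ≤ (W n:ℝ) ∧ (W n:ℝ) ≤ t * Real.sqrt n + 1 := by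
    intro n
    have h0 : 0 ≤ t * Real.sqrt n := by positivity
    have h1 := Nat.floor_le h0
    have h2 := Nat.lt_floor_add_one (t * Real.sqrt n)
    simp only [hWdef]
    push_cast
    constructor <;> linarith
  have hW : Tendsto (fun n : ℕ => (W n : ℝ)/Real.sqrt n) atTop (𝓝 t) := by
    refine floor_tendsto t W fun n => ?_
    rw [abs_le]
    constructor <;> linarith [(hb n).1, (hb n).2]
  have hev := seq_ev W (fun _ => 0) t 0 ht hW (by simp)
  obtain ⟨C, hC, hdl⟩ := dl_bound p (t+2) (t/2) (by positivity) (by positivity)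
  -- uniform bound on the step function
  have hbd : ∀ᶠ n : ℕ in atTop, ∀ w : ℝ, 0 ≤ w → w ≤ t+1 → ‖dl p n (W n) ⌊w * Real.sqrt n⌋‖ ≤ C := by
    filter_upwards [hev] with n hn w hw0 hw1
    have hq : 1 ≤ Real.sqrt n := Real.one_le_sqrt.2 (by exact_mod_cast hn.1)
    refine hdl n hn.1 _ _ ?_ hn.2.2
    have h1 := Int.floor_le (w * Real.sqrt n)
    have h2 : (0:ℝ) ≤ ((⌊w * Real.sqrt n⌋ : ℤ):ℝ) := by
      exact_mod_cast Int.floor_nonneg.2 (by positivity)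
    rw [abs_of_nonneg h2]
    nlinarith
  have hmeas : ∀ n : ℕ, Measurable (fun w : ℝ => dl p n (W n) ⌊w * Real.sqrt n⌋) := by
    intro n
    have h1 : Measurable (fun w : ℝ => ⌊w * Real.sqrt n⌋) := Int.measurable_floor.comp (measurable_id.mul_const _)
    exact (measurable_from_top (f := fun k : ℤ => dl p n (W n) k)).comp h1
  have hint : ∀ᶠ n : ℕ in atTop, ∀ a b : ℝ, 0 ≤ a → a ≤ b → b ≤ t+1 →
      IntervalIntegrable (fun w : ℝ => dl p n (W n) ⌊w * Real.sqrt n⌋) volume a b := by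
    filter_upwards [hbd] with n hn a b ha hab hbt
    refine (intervalIntegrable_const (c := C)).mono_fun (hmeas n).aestronglyMeasurable ?_
    rw [Filter.EventuallyLE, ae_restrict_iff' measurableSet_uIoc]
    refine Eventually.of_forall fun w hw => ?_
    rw [Set.uIoc_of_le hab] at hw
    refine (hn w (by linarith [hw.1]) (by linarith [hw.2])).trans ?_
    exact le_abs_self C
  have hmain : Tendsto (fun n : ℕ => ∫ w in (0:ℝ)..t, dl p n (W n) ⌊w * Real.sqrt n⌋) atTop
      (𝓝 (∫ w in (0:ℝ)..t, deriv (fun z => Tfun p z w) t)) := by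
    refine intervalIntegral.tendsto_integral_filter_of_dominated_convergence (fun _ => C) ?_ ?_ ?_ ?_
    · exact Eventually.of_forall fun n => (hmeas n).aestronglyMeasurable
    · filter_upwards [hbd] with n hn
      refine Eventually.of_forall fun w hw => ?_
      rw [Set.uIoc_of_le ht.le] at hw
      exact hn w hw.1.le (by linarith [hw.2])
    · exact intervalIntegrable_const
    · refine Eventually.of_forall fun w _ => ?_
      exact dl_tendsto p W _ t w ht hW (floor_tendsto' w)
  have hrest : Tendsto (fun n : ℕ => ∫ w in t..((W n:ℝ)/Real.sqrt n), dl p n (W n) ⌊w * Real.sqrt n⌋) atTop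
      (𝓝 0) := by
    have h0 : Tendsto (fun n : ℕ => C * |(W n:ℝ)/Real.sqrt n - t|) atTop (𝓝 0) := by
      have := (hW.sub_const t).abs.const_mul C
      simpa using this
    refine squeeze_zero_norm' ?_ h0
    filter_upwards [hbd, hev] with n hn hn2
    have hq : 1 ≤ Real.sqrt n := Real.one_le_sqrt.2 (by exact_mod_cast hn2.1)
    refine intervalIntegral.norm_integral_le_of_norm_le_const fun w hw => ?_
    have h1 : t ≤ (W n:ℝ)/Real.sqrt n := by rw [le_div_iff₀ (by linarith)]; exact (hb n).1
    have h2 : (W n:ℝ)/Real.sqrt n ≤ t + 1 := by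
      rw [div_le_iff₀ (by linarith)]; linarith [(hb n).2]
    rw [Set.uIoc_of_le h1] at hw
    exact hn w (by linarith [hw.1]) (by linarith [hw.2])
  have := hmain.add hrest
  rw [add_zero] at this
  refine this.congr' ?_
  filter_upwards [hint, hev] with n hn hn2
  have hq : 1 ≤ Real.sqrt n := Real.one_le_sqrt.2 (by exact_mod_cast hn2.1)
  have h1 : t ≤ (W n:ℝ)/Real.sqrt n := by rw [le_div_iff₀ (by linarith)]; exact (hb n).1
  have h2 : (W n:ℝ)/Real.sqrt n ≤ t + 1 := by
    rw [div_le_iff₀ (by linarith)]; linarith [(hb n).2]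
  rw [intervalIntegral.integral_add_adjacent_intervals (hn 0 t le_rfl ht.le (by linarith))
    (hn t _ ht.le h1 h2)]
  simp only [hWdef, Int.cast_natCast]

theorem main_tendsto (p : ℕ) (hp : 0 < p) (t : ℝ) (ht : 0 < t) :
    Filter.Tendsto
      (fun n : ℕ =>
        (Nat.card {y : Fin p → Fin (2*n+1) → ℤ //
            IsMelon p n y ∧ ((melonRange y : ℝ) + 1)/Real.sqrt n ≤ t} : ℝ) /
          (Nat.card {y : Fin p → Fin (2*n+1) → ℤ // IsMelon p n y} : ℝ))
      atTop
      (nhds ((((2:ℝ)^(p.choose 2))⁻¹ / ∏ i ∈ Finset.range p, (i.factorial : ℝ)) *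
        ∫ w in (0:ℝ)..t, deriv (fun z => Tfun p z w) t)) := by
  have hprod : (2:ℝ)^(p.choose 2) * ∏ i ∈ Finset.range p, (i.factorial : ℝ) ≠ 0 := by
    refine mul_ne_zero (by positivity) (Finset.prod_ne_zero_iff.2 fun i _ => ?_)
    exact_mod_cast i.factorial_ne_zero
  have hlim := (int_tendsto p t ht).div (TT_tendsto p) hprod
  have he : (((2:ℝ)^(p.choose 2))⁻¹ / ∏ i ∈ Finset.range p, (i.factorial : ℝ)) *
        ∫ w in (0:ℝ)..t, deriv (fun z => Tfun p z w) t =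
      (∫ w in (0:ℝ)..t, deriv (fun z => Tfun p z w) t) /
      ((2:ℝ)^(p.choose 2) * ∏ i ∈ Finset.range p, (i.factorial : ℝ)) := by
    rw [div_eq_mul_inv, div_eq_mul_inv, mul_inv]; ring
  rw [he]
  refine hlim.congr' ?_
  have hbig : ∀ᶠ n : ℕ in atTop, 1 / t ≤ Real.sqrt n := sqrt_atTop.eventually_ge_atTop _
  filter_upwards [hbig, eventually_ge_atTop 1] with n hn1 hn
  have hq : 0 < Real.sqrt n := Real.sqrt_pos.2 (by exact_mod_cast hn)
  simp only [Pi.div_apply]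
  rw [step_int (fun s => dl p n ((⌊t * Real.sqrt n⌋₊ + 1 : ℕ) : ℤ) s) _ hq]
  have h1 : 1 ≤ t * Real.sqrt n := by rwa [div_le_iff₀' ht] at hn1
  obtain ⟨r, hr⟩ : ∃ r : ℕ, ⌊t * Real.sqrt n⌋₊ = r + 1 :=
    ⟨⌊t * Real.sqrt n⌋₊ - 1, by have := (Nat.one_le_floor_iff _).2 h1; omega⟩
  have hev : ∀ y : Fin p → Fin (2*n+1) → ℤ,
      ((melonRange y : ℝ) + 1)/Real.sqrt n ≤ t ↔ melonRange y ≤ r := by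
    intro y
    rw [div_le_iff₀ hq]
    have hz : ⌊t * Real.sqrt n⌋ = (r:ℤ) + 1 := by
      rw [← Int.natCast_floor_eq_floor (by positivity), hr]; push_cast; ring
    have : ((melonRange y : ℝ) + 1 ≤ t * Real.sqrt n) ↔ melonRange y + 1 ≤ ⌊t * Real.sqrt n⌋ := by
      rw [Int.le_floor]; push_cast; rfl
    rw [this, hz]
    omega
  simp only [hev]
  have htot : (Nat.card {y : Fin p → Fin (2*n+1) → ℤ // IsMelon p n y} : ℝ) =
      (Nat.card (melonIn p n Set.univ) : ℝ) := by
    have : melonIn p n Set.univ = {y | IsMelon p n y} := by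
      ext y; simp [melonIn]
    rw [this]; rfl
  rw [htot, count_sum p n hp r, hr]
  have hQ := (QQ_pos p n hn).ne'
  have hB : Bw (2*n) 0 ^ p ≠ 0 := pow_ne_zero _ (by simpa using (Bw_pos n).ne')
  rw [← mul_div_mul_left _ (Nat.card (melonIn p n Set.univ) : ℝ) hQ, total_eq,
    ← mul_div_mul_left _ (TT p n).det hB]
  congr 1
  rw [Finset.mul_sum, Finset.mul_sum, Finset.mul_sum]
  refine Finset.sum_congr rfl fun s _ => ?_
  rw [mul_sub, FF_eq _ _ _ _ (by omega), FF_eq _ _ _ _ (by omega)]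
  unfold dl
  have e1 : ((r + 1 + 1 : ℕ):ℤ) = (r:ℤ)+2 := by push_cast; ring
  rw [e1, show (r:ℤ)+2-1 = (r:ℤ)+1 by ring]
  field_simp

/-- Weak limit of the range of a random `p`-watermelon:
`P{(R_{n,p}+1)/√n ≤ t} → (2^{-C(p,2)}/Π_{i<p} i!) ∫_0^t (∂_z T_p(z,w))|_{z=t} dw`. -/
theorem stmt17 (p : ℕ) (hp : 0 < p) (t : ℝ) (ht : 0 < t) :
    Filter.Tendsto
      (fun n : ℕ =>
        (Nat.card {y : Fin p → Fin (2*n+1) → ℤ //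
            IsMelon p n y ∧ ((melonRange y : ℝ) + 1)/Real.sqrt n ≤ t} : ℝ) /
          (Nat.card {y : Fin p → Fin (2*n+1) → ℤ // IsMelon p n y} : ℝ))
      atTop
      (nhds ((((2:ℝ)^(p.choose 2))⁻¹ / ∏ i ∈ Finset.range p, (i.factorial : ℝ)) *
        ∫ w in (0:ℝ)..t, deriv (fun z => Tfun p z w) t)) :=
  main_tendsto p hp t ht
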